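/- arXiv:1207.6249 — 3 statements merged into one kernel-verified Lean document; each statement's English description precedes it below -/
import Mathlib

section
/- Let G be a graph on [n] with {1,2} ∈ E(G) and such that no vertex i > 2 is adjacent to both 1 and 2, and let I = I(Ḡ) ⊂ S = K[x_1,…,x_n]. Then depth S/(I^∨ ∩ (x_1,x_2)) ≥ depth S/I^∨. -/
open MvPolynomial

noncomputable section

/-- The irrelevant (graded maximal) ideal `(x_i : i)` of a polynomial ring. -/
def irrelevantIdeal (K : Type) [Field K] (σ : Type) : Ideal (MvPolynomial σ K) :=
  Ideal.span (Set.range (X : σ → MvPolynomial σ K))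

/-- `depthIdeal m M` is the depth of the module `M` with respect to the ideal `m`:
the supremum of lengths of `M`-regular sequences with entries in `m`. -/
def depthIdeal {R : Type} [CommRing R] (m : Ideal R)
    (M : Type) [AddCommGroup M] [Module R M] : ℕ :=
  sSup {k | ∃ rs : List R, rs.length = k ∧ (∀ r ∈ rs, r ∈ m) ∧
    RingTheory.Sequence.IsRegular M rs}

/-- `I` is a squarefree monomial ideal: generated by squarefree monomials. -/
def IsSqFreeMonomialIdeal {K : Type} [Field K] {σ : Type}
    (I : Ideal (MvPolynomial σ K)) : Prop :=
  ∃ 𝒮 : Set (Finset σ),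
    I = Ideal.span ((fun s : Finset σ => ∏ i ∈ s, (X i : MvPolynomial σ K)) '' 𝒮)

/-- `I` is a squarefree monomial ideal generated in degree `d`. -/
def IsSqFreeMonomialIdealInDegree {K : Type} [Field K] {σ : Type}
    (I : Ideal (MvPolynomial σ K)) (d : ℕ) : Prop :=
  ∃ 𝒮 : Set (Finset σ), (∀ s ∈ 𝒮, s.card = d) ∧
    I = Ideal.span ((fun s : Finset σ => ∏ i ∈ s, (X i : MvPolynomial σ K)) '' 𝒮)

/-- The Alexander dual of a squarefree monomial ideal: the intersection of the prime
ideals `P_M = (x_i : x_i ∣ M)` over the (squarefree) monomials `M` in `I`. -/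
def alexDual {K : Type} [Field K] {σ : Type}
    (I : Ideal (MvPolynomial σ K)) : Ideal (MvPolynomial σ K) :=
  ⨅ (s : Finset σ) (_ : (∏ i ∈ s, (X i : MvPolynomial σ K)) ∈ I),
    Ideal.span ((fun i : σ => (X i : MvPolynomial σ K)) '' ↑s)

/-- The edge ideal of a simple graph. -/
def edgeIdeal (K : Type) [Field K] {σ : Type} (G : SimpleGraph σ) :
    Ideal (MvPolynomial σ K) :=
  Ideal.span {p | ∃ i j : σ, G.Adj i j ∧ p = X i * X j}

/-- A minimal graded free resolution of a (homogeneous) ideal `I` in a polynomial ring: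
an exact sequence `⋯ → F₁ → F₀ → I → 0` of free modules `Fᵢ = ⊕ S(-degᵢ b)`, with
degree-zero (homogeneous) differentials whose matrix entries lie in the irrelevant
maximal ideal (minimality). -/
structure MinimalGradedFreeResolution {K : Type} [Field K] {σ : Type}
    (I : Ideal (MvPolynomial σ K)) where
  ι : ℕ → Type
  finite : ∀ i, Finite (ι i)
  deg : ∀ i, ι i → ℕ
  d : ∀ i, (ι (i + 1) →₀ MvPolynomial σ K) →ₗ[MvPolynomial σ K]
      (ι i →₀ MvPolynomial σ K)
  ε : (ι 0 →₀ MvPolynomial σ K) →ₗ[MvPolynomial σ K] MvPolynomial σ K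
  range_ε : LinearMap.range ε = I
  exact_ε : LinearMap.ker ε = LinearMap.range (d 0)
  exact_d : ∀ i, LinearMap.ker (d i) = LinearMap.range (d (i + 1))
  homog_ε : ∀ b : ι 0, (ε (Finsupp.single b 1)).IsHomogeneous (deg 0 b)
  homog_d : ∀ i, ∀ b : ι (i + 1), ∀ c : ι i,
      (d i (Finsupp.single b 1)) c = 0 ∨
      (deg i c ≤ deg (i + 1) b ∧
        ((d i (Finsupp.single b 1)) c).IsHomogeneous (deg (i + 1) b - deg i c))
  minimal : ∀ i, ∀ b : ι (i + 1), ∀ c : ι i,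
      constantCoeff ((d i (Finsupp.single b 1)) c) = 0

namespace MinimalGradedFreeResolution

variable {K : Type} [Field K] {σ : Type} {I : Ideal (MvPolynomial σ K)}

/-- The graded Betti number `β_{i,j}` read off from a minimal graded free resolution. -/
def betti (R : MinimalGradedFreeResolution I) (i j : ℕ) : ℕ :=
  Nat.card {b : R.ι i // R.deg i b = j}

end MinimalGradedFreeResolution

/-- The graded Betti number `β_{i,j}(I)` (well defined since all minimal graded free
resolutions of `I` have the same Betti numbers). -/
def bettiNumber {K : Type} [Field K] {σ : Type} (I : Ideal (MvPolynomial σ K))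
    (i j : ℕ) : ℕ :=
  sSup {b | ∃ R : MinimalGradedFreeResolution I, R.betti i j = b}

/-- Castelnuovo–Mumford regularity: `reg I = sup { j - i : β_{i,j}(I) ≠ 0 }`. -/
def reg {K : Type} [Field K] {σ : Type} (I : Ideal (MvPolynomial σ K)) : ℕ :=
  sSup {r | ∃ i j : ℕ, bettiNumber I i j ≠ 0 ∧ j = i + r}

/-- The initial degree of a homogeneous ideal: the least degree of a nonzero
homogeneous element. -/
def indeg {K : Type} [Field K] {σ : Type} (I : Ideal (MvPolynomial σ K)) : ℕ :=
  sInf {d | ∃ p ∈ I, p ≠ 0 ∧ MvPolynomial.IsHomogeneous p d}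

/-- `I` has a `d`-linear resolution: it admits a minimal graded free resolution all of
whose Betti numbers are concentrated in `β_{i,i+d}`. -/
def HasLinearResolution {K : Type} [Field K] {σ : Type}
    (I : Ideal (MvPolynomial σ K)) (dd : ℕ) : Prop :=
  ∃ R : MinimalGradedFreeResolution I, ∀ i j : ℕ, R.betti i j ≠ 0 → j = i + dd

end

namespace Stmt13Aux

open RingTheory.Sequence CategoryTheory Abelian

/-- The length of a regular sequence is at most the dimension of the support. -/
lemma length_le_supportDim {R : Type} [CommRing R] (rs : List R) (M : Type) [AddCommGroup M]
    [Module R M] [Module.Finite R M] (h : IsRegular M rs) :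
    (rs.length : WithBot ℕ∞) ≤ Module.supportDim R M := by
  induction rs generalizing M with
  | nil =>
    have := h.nontrivial
    have hne := Module.supportDim_ne_bot_of_nontrivial R M
    obtain ⟨d, hd⟩ := WithBot.ne_bot_iff_exists.mp hne
    rw [← hd]
    simp
  | cons r rs ih =>
    rw [isRegular_cons_iff] at h
    have h1 := ih (QuotSMulTop r M) h.2
    have h2 := Module.supportDim_quotSMulTop_succ_le_of_notMem_minimalPrimes (M := M) (x := r)
      (fun _ ↦ h.1.notMem_of_mem_minimalPrimes)
    refine le_trans ?_ h2
    push_cast [List.length_cons]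
    gcongr

/-- Middle-term depth lemma, phrased with regular sequences. -/
lemma exists_regular_middle {R : Type} [CommRing R] [IsNoetherianRing R] (m : Ideal R) (d : ℕ)
    {A B C : Type} [AddCommGroup A] [AddCommGroup B] [AddCommGroup C]
    [Module R A] [Module R B] [Module R C]
    [Module.Finite R A] [Module.Finite R B] [Module.Finite R C]
    (hA : m • (⊤ : Submodule R A) < ⊤) (hB : m • (⊤ : Submodule R B) < ⊤)
    (hC : m • (⊤ : Submodule R C) < ⊤)
    (f : A →ₗ[R] B) (g : B →ₗ[R] C) (hf : Function.Injective f) (hg : Function.Surjective g)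
    (hfg : Function.Exact f g)
    (rA : ∃ rs : List R, rs.length = d ∧ (∀ r ∈ rs, r ∈ m) ∧ IsRegular A rs)
    (rC : ∃ rs : List R, rs.length = d ∧ (∀ r ∈ rs, r ∈ m) ∧ IsRegular C rs) :
    ∃ rs : List R, rs.length = d ∧ (∀ r ∈ rs, r ∈ m) ∧ IsRegular B rs := by
  have hSE : (ModuleCat.shortComplexOfCompEqZero f g hfg.linearMap_comp_eq_zero).ShortExact :=
    ModuleCat.shortComplex_shortExact _ hfg hf hg
  have eA := ((ModuleCat.exists_isRegular_tfae m d (ModuleCat.of R A) hA).out 1 3).mpr rA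
  have eC := ((ModuleCat.exists_isRegular_tfae m d (ModuleCat.of R C) hC).out 1 3).mpr rC
  refine ((ModuleCat.exists_isRegular_tfae m d (ModuleCat.of R B) hB).out 1 3).mp ?_
  intro i hi
  have zero1 := AddCommGrpCat.isZero_of_iff_subsingleton.mpr (eA i hi)
  have zero2 := AddCommGrpCat.isZero_of_iff_subsingleton.mpr (eC i hi)
  exact AddCommGrpCat.subsingleton_of_isZero <| ShortComplex.Exact.isZero_of_both_zeros
    (Ext.covariant_sequence_exact₂' _ hSE i)
    (zero1.eq_zero_of_src _) (zero2.eq_zero_of_tgt _)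

lemma smul_top_lt {R : Type} [CommRing R] {m J : Ideal R} (hm : m ≠ ⊤) (hJ : J ≤ m) :
    m • (⊤ : Submodule R (R ⧸ J)) < ⊤ := by
  rw [lt_top_iff_ne_top]
  intro h
  have h1 := congrArg (Submodule.comap (Submodule.mkQ J)) h
  rw [Submodule.comap_smul_top_of_surjective _ _ (Submodule.mkQ_surjective _)] at h1
  simp [hJ] at h1
  exact hm h1

section poly

variable {K : Type} [Field K] {σ : Type}

lemma X_mul_mem {s : Set σ} {c : σ} (hc : c ∉ s) {f : MvPolynomial σ K}
    (h : X c * f ∈ Ideal.span ((X : σ → MvPolynomial σ K) '' s)) :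
    f ∈ Ideal.span ((X : σ → MvPolynomial σ K) '' s) := by
  rw [mem_ideal_span_X_image] at h ⊢
  intro m hm
  obtain ⟨i, hi, h0⟩ := h (Finsupp.single c 1 + m) (by
    rw [mem_support_iff, coeff_X_mul]; exact mem_support_iff.mp hm)
  refine ⟨i, hi, ?_⟩
  have : c ≠ i := fun e => hc (e ▸ hi)
  simpa [Finsupp.single_apply, this] using h0

lemma prod_mul_mem {s : Set σ} (t : Finset σ) (ht : ∀ c ∈ t, c ∉ s) {f : MvPolynomial σ K}
    (h : (∏ c ∈ t, X c) * f ∈ Ideal.span ((X : σ → MvPolynomial σ K) '' s)) :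
    f ∈ Ideal.span ((X : σ → MvPolynomial σ K) '' s) := by
  classical
  induction t using Finset.induction_on with
  | empty => simpa using h
  | insert c t hc ih =>
    rw [Finset.prod_insert hc, mul_assoc] at h
    exact ih (fun d hd => ht d (Finset.mem_insert_of_mem hd))
      (X_mul_mem (ht c (Finset.mem_insert_self _ _)) h)

lemma ofList_X (l : List σ) :
    Ideal.ofList (l.map (X : σ → MvPolynomial σ K)) = Ideal.span (X '' {i | i ∈ l}) := by
  unfold Ideal.ofList
  congr 1
  ext p
  simp

lemma weaklyRegular_X (l : List σ) (hl : l.Nodup) :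
    IsWeaklyRegular (MvPolynomial σ K) (l.map (X : σ → MvPolynomial σ K)) := by
  refine ⟨fun i hi => ?_⟩
  rw [isSMulRegular_iff_right_eq_zero_of_smul]
  intro q hq
  obtain ⟨f, rfl⟩ := Submodule.mkQ_surjective _ q
  rw [← map_smul, Submodule.mkQ_apply, Submodule.Quotient.mk_eq_zero] at hq
  rw [Submodule.mkQ_apply, Submodule.Quotient.mk_eq_zero]
  simp only [← List.map_take, List.getElem_map, smul_eq_mul, Ideal.mul_top] at hq ⊢
  rw [ofList_X] at hq ⊢
  refine X_mul_mem ?_ hq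
  intro hmem
  simp only [List.length_map] at hi
  rw [Set.mem_ofPred_eq, List.mem_take_iff_getElem] at hmem
  obtain ⟨j, hj, he⟩ := hmem
  have := (hl.getElem_inj_iff).mp he
  omega

lemma irrelevant_eq : irrelevantIdeal K σ = Ideal.span (X '' Set.univ) := by
  rw [irrelevantIdeal, Set.image_univ]

lemma irrelevant_ne_top : irrelevantIdeal K σ ≠ ⊤ := by
  intro h
  rw [Ideal.eq_top_iff_one, irrelevant_eq, mem_ideal_span_X_image] at h
  obtain ⟨i, _, hi⟩ := h 0 (by simp)
  simp at hi

lemma span_X_le (s : Set σ) : Ideal.span ((X : σ → MvPolynomial σ K) '' s)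
    ≤ irrelevantIdeal K σ := by
  rw [irrelevant_eq]
  exact Ideal.span_mono (Set.image_mono (Set.subset_univ s))

lemma top_ne_of_le {R : Type} [CommRing R] {m J : Ideal R} (hm : m ≠ ⊤) (hJ : J ≤ m)
    {rs : List R} (hrs : ∀ r ∈ rs, r ∈ m) (h : IsWeaklyRegular (R ⧸ J) rs) :
    IsRegular (R ⧸ J) rs := by
  refine ⟨h, fun e => (smul_top_lt hm hJ).ne ?_⟩
  have h1 : Ideal.ofList rs ≤ m := Ideal.span_le.mpr hrs
  exact le_antisymm le_top (e.le.trans (Submodule.smul_mono_left h1))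

/-- The remaining variables form a regular sequence modulo a set of variables. -/
lemma regular_rest (l₁ l₂ : List σ) (hl : (l₁ ++ l₂).Nodup) :
    IsRegular (MvPolynomial σ K ⧸ Ideal.span ((X : σ → MvPolynomial σ K) '' {i | i ∈ l₁}))
      (l₂.map (X : σ → MvPolynomial σ K)) := by
  refine top_ne_of_le irrelevant_ne_top (span_X_le _) ?_ ?_
  · intro r hr
    obtain ⟨i, _, rfl⟩ := List.mem_map.mp hr
    exact Ideal.subset_span ⟨i, rfl⟩
  · have := weaklyRegular_X (K := K) _ hl
    rw [List.map_append, isWeaklyRegular_append_iff] at this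
    have h2 := this.2
    rw [ofList_X, smul_eq_mul, Ideal.mul_top] at h2
    exact h2

end poly

section dim

lemma supportDim_add_length_le {R : Type} [CommRing R] (rs : List R) (M : Type) [AddCommGroup M]
    [Module R M] [Module.Finite R M] (h : IsWeaklyRegular M rs) :
    Module.supportDim R (M ⧸ Ideal.ofList rs • (⊤ : Submodule R M)) + rs.length
      ≤ Module.supportDim R M := by
  induction rs generalizing M with
  | nil =>
    rw [Ideal.ofList_nil, Submodule.bot_smul]
    simpa using (Module.supportDim_eq_of_equiv (Submodule.quotEquivOfEqBot ⊥ rfl)).le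
  | cons r rs ih =>
    rw [isWeaklyRegular_cons_iff] at h
    have h1 := ih (QuotSMulTop r M) h.2
    have h2 := Module.supportDim_quotSMulTop_succ_le_of_notMem_minimalPrimes (M := M) (x := r)
      (fun _ ↦ h.1.notMem_of_mem_minimalPrimes)
    refine le_trans ?_ h2
    rw [Module.supportDim_eq_of_equiv
      (Submodule.quotOfListConsSMulTopEquivQuotSMulTopInner M r _)]
    push_cast [List.length_cons]
    rw [← add_assoc]
    gcongr

variable {K : Type} [Field K] {n : ℕ}

lemma supportDim_two (i j : Fin n) (hij : i ≠ j) :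
    Module.supportDim (MvPolynomial (Fin n) K)
      (MvPolynomial (Fin n) K ⧸ Ideal.span ((X : _ → MvPolynomial (Fin n) K) '' {i, j}))
      ≤ ((n - 2 : ℕ) : WithBot ℕ∞) := by
  have hn : 2 ≤ n := by
    have h1 := i.2
    have h2 := j.2
    have h3 : i.1 ≠ j.1 := fun h => hij (Fin.ext h)
    omega
  have h := supportDim_add_length_le _ _ (weaklyRegular_X (K := K) [i, j] (by simp [hij]))
  rw [ofList_X, smul_eq_mul, Ideal.mul_top, Module.supportDim_self_eq_ringKrullDim,
    MvPolynomial.ringKrullDim_of_isNoetherianRing, ringKrullDim_eq_zero_of_field] at h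
  have hs : ({k | k ∈ [i, j]} : Set (Fin n)) = {i, j} := by ext; simp
  rw [hs] at h
  have h' : Module.supportDim (MvPolynomial (Fin n) K)
      (MvPolynomial (Fin n) K ⧸ Ideal.span ((X : _ → MvPolynomial (Fin n) K) '' {i, j}))
      + ((2 : ℕ) : WithBot ℕ∞) ≤ ((n - 2 : ℕ) : WithBot ℕ∞) + ((2 : ℕ) : WithBot ℕ∞) := by
    rw [← Nat.cast_add, Nat.sub_add_cancel hn]
    simpa using h
  revert h'
  generalize Module.supportDim (MvPolynomial (Fin n) K) (MvPolynomial (Fin n) K ⧸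
    Ideal.span ((X : _ → MvPolynomial (Fin n) K) '' {i, j})) = x
  intro h'
  induction x with
  | bot => exact bot_le
  | coe d =>
    have h3 : d + ((2 : ℕ) : ℕ∞) ≤ ((n - 2 : ℕ) : ℕ∞) + ((2 : ℕ) : ℕ∞) :=
      WithBot.coe_le_coe.mp h'
    have h4 : d ≤ ((n - 2 : ℕ) : ℕ∞) := (ENat.add_le_add_iff_right (by simp)).mp h3
    exact WithBot.coe_le_coe.mpr h4

lemma supportDim_inf (E : Finset (Fin n × Fin n)) (hE : ∀ e ∈ E, e.1 ≠ e.2) :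
    Module.supportDim (MvPolynomial (Fin n) K)
      (MvPolynomial (Fin n) K ⧸ E.inf
        (fun e => Ideal.span ((X : _ → MvPolynomial (Fin n) K) '' {e.1, e.2})))
      ≤ ((n - 2 : ℕ) : WithBot ℕ∞) := by
  refine iSup_le fun p => ?_
  have hhead := p.head.2
  rw [Module.mem_support_iff_of_finite, Ideal.annihilator_quotient,
    Ideal.IsPrime.inf_le' p.head.1.2] at hhead
  obtain ⟨e, he, hle⟩ := hhead
  refine le_trans ?_ (supportDim_two (K := K) e.1 e.2 (hE e he))
  set Q := Ideal.span ((X : _ → MvPolynomial (Fin n) K) '' {e.1, e.2})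
  let q : LTSeries (Module.support (MvPolynomial (Fin n) K) (MvPolynomial (Fin n) K ⧸ Q)) :=
    { length := p.length
      toFun := fun k => ⟨(p k).1, by
        rw [Module.mem_support_iff_of_finite, Ideal.annihilator_quotient]
        have h0 : p.head ≤ p k := p.head_le k
        exact hle.trans h0⟩
      step := fun k => p.step k }
  exact le_iSup (fun q : LTSeries (Module.support (MvPolynomial (Fin n) K)
    (MvPolynomial (Fin n) K ⧸ Q)) => (q.length : WithBot ℕ∞)) q

end dim

section graph

variable {K : Type} [Field K] {σ : Type}

lemma exists_edge {G : SimpleGraph σ} {s : Finset σ}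
    (h : (∏ i ∈ s, (X i : MvPolynomial σ K)) ∈ edgeIdeal K G) :
    ∃ i ∈ s, ∃ j ∈ s, G.Adj i j := by
  classical
  by_contra! hno
  let φ : MvPolynomial σ K →+* K := eval (fun i => if i ∈ s then 1 else 0)
  have hle : edgeIdeal K G ≤ RingHom.ker φ := by
    refine Ideal.span_le.mpr ?_
    rintro p ⟨i, j, hij, rfl⟩
    simp only [SetLike.mem_coe, RingHom.mem_ker, φ, map_mul, eval_X]
    by_cases hi : i ∈ s
    · by_cases hj : j ∈ s
      · exact absurd hij (hno i hi j hj)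
      · simp [hj]
    · simp [hi]
  have := hle h
  rw [RingHom.mem_ker, map_prod] at this
  have h1 : ∏ i ∈ s, φ (X i) = 1 := Finset.prod_eq_one fun i hi => by simp [φ, hi]
  rw [h1] at this
  exact one_ne_zero this

lemma mem_alexDual {G : SimpleGraph σ} {f : MvPolynomial σ K} :
    f ∈ alexDual (edgeIdeal K G) ↔
      ∀ i j, G.Adj i j → f ∈ Ideal.span ((X : σ → MvPolynomial σ K) '' {i, j}) := by
  classical
  simp only [alexDual, Submodule.mem_iInf]
  constructor
  · intro h i j hij
    have := h {i, j} (by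
      rw [Finset.prod_pair hij.ne]
      exact Ideal.subset_span ⟨i, j, hij, rfl⟩)
    simpa using this
  · intro h s hs
    obtain ⟨i, hi, j, hj, hij⟩ := exists_edge hs
    refine Ideal.span_mono (Set.image_mono ?_) (h i j hij)
    intro k hk
    rcases hk with rfl | rfl
    · exact hi
    · exact hj

lemma alexDual_eq_inf {n : ℕ} (G : SimpleGraph (Fin n)) :
    ∃ E : Finset (Fin n × Fin n), (∀ e ∈ E, e.1 ≠ e.2) ∧
      alexDual (edgeIdeal K G) = E.inf
        (fun e => Ideal.span ((X : _ → MvPolynomial (Fin n) K) '' {e.1, e.2})) := by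
  classical
  refine ⟨Finset.univ.filter fun e => G.Adj e.1 e.2, fun e he => ?_, ?_⟩
  · exact (Finset.mem_filter.mp he).2.ne
  · ext f
    rw [mem_alexDual, Submodule.mem_finsetInf]
    simp

end graph

section main

variable {K : Type} [Field K] {n : ℕ} (G : SimpleGraph (Fin n)) (a b : Fin n)

/-- The product of all variables other than `a` and `b`. -/
noncomputable def wprod (K : Type) [Field K] {n : ℕ} (a b : Fin n) : MvPolynomial (Fin n) K :=
  ∏ c ∈ (Finset.univ.erase a).erase b, X c

lemma wprod_mem (hab : G.Adj a b) : wprod K a b ∈ alexDual (edgeIdeal K Gᶜ) := by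
  rw [mem_alexDual]
  have key : ∀ c : Fin n, c ≠ a → c ≠ b → ∀ s : Set (Fin n), c ∈ s →
      wprod K a b ∈ Ideal.span ((X : _ → MvPolynomial (Fin n) K) '' s) := by
    intro c hca hcb s hc
    exact Ideal.mem_of_dvd _ (Finset.dvd_prod_of_mem _ (by simp [hca, hcb]))
      (Ideal.subset_span ⟨c, hc, rfl⟩)
  intro i j hij
  rw [SimpleGraph.compl_adj] at hij
  by_cases hi : i ≠ a ∧ i ≠ b
  · exact key i hi.1 hi.2 _ (by simp)
  · by_cases hj : j ≠ a ∧ j ≠ b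
    · exact key j hj.1 hj.2 _ (by simp)
    · exfalso
      have h1 : i = a ∨ i = b := by tauto
      have h2 : j = a ∨ j = b := by tauto
      rcases h1 with rfl | rfl <;> rcases h2 with rfl | rfl
      · exact hij.1 rfl
      · exact hij.2 hab
      · exact hij.2 hab.symm
      · exact hij.1 rfl

lemma decomp (htri : ∀ c : Fin n, c ≠ a → c ≠ b → ¬ (G.Adj a c ∧ G.Adj b c))
    {f : MvPolynomial (Fin n) K} (hf : f ∈ alexDual (edgeIdeal K Gᶜ)) :
    ∃ g, f - wprod K a b * g ∈ Ideal.span ((X : _ → MvPolynomial (Fin n) K) '' {a, b}) := by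
  classical
  rw [mem_alexDual] at hf
  suffices h : f ∈ Ideal.span ((X : _ → MvPolynomial (Fin n) K) '' {a, b}) ⊔
      Ideal.span {wprod K a b} by
    obtain ⟨p, hp, q, hq, rfl⟩ := Submodule.mem_sup.mp h
    obtain ⟨g, rfl⟩ := Ideal.mem_span_singleton'.mp hq
    exact ⟨g, by rw [mul_comm g]; simpa using hp⟩
  rw [f.as_sum]
  refine Ideal.sum_mem _ fun m hm => ?_
  by_cases hmab : m a ≠ 0 ∨ m b ≠ 0
  · refine Ideal.mem_sup_left ?_
    rw [mem_ideal_span_X_image]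
    intro m' hm'
    have : m' = m := by
      have := support_monomial_subset hm'
      simpa using this
    subst this
    rcases hmab with h | h
    · exact ⟨a, by simp, h⟩
    · exact ⟨b, by simp, h⟩
  · push Not at hmab
    refine Ideal.mem_sup_right ?_
    have hne : ∀ c : Fin n, c ≠ a → c ≠ b → m c ≠ 0 := by
      intro c hca hcb
      have h3 := htri c hca hcb
      by_cases hac : G.Adj a c
      · have hbc : Gᶜ.Adj b c := by
          rw [SimpleGraph.compl_adj]; exact ⟨hcb.symm, fun h => h3 ⟨hac, h⟩⟩
        obtain ⟨i, hi, h0⟩ := mem_ideal_span_X_image.mp (hf b c hbc) m hm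
        rcases hi with rfl | rfl
        · exact absurd hmab.2 h0
        · exact h0
      · have hac' : Gᶜ.Adj a c := by
          rw [SimpleGraph.compl_adj]; exact ⟨hca.symm, hac⟩
        obtain ⟨i, hi, h0⟩ := mem_ideal_span_X_image.mp (hf a c hac') m hm
        rcases hi with rfl | rfl
        · exact absurd hmab.1 h0
        · exact h0
    have hw : wprod K a b =
        monomial (∑ c ∈ (Finset.univ.erase a).erase b, Finsupp.single c 1) (1 : K) := by
      rw [wprod, monomial_sum_one]
      rfl
    rw [Ideal.mem_span_singleton, hw, monomial_dvd_monomial]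
    refine ⟨Or.inr ?_, one_dvd _⟩
    intro c
    rw [Finsupp.finsetSum_apply]
    by_cases hc : c ∈ (Finset.univ.erase a).erase b
    · rw [Finset.sum_eq_single_of_mem c hc (fun d _ hd => by simp [hd])]
      simp at hc
      simpa [Nat.one_le_iff_ne_zero] using hne c hc.2 hc.1
    · rw [Finset.sum_eq_zero]
      · exact Nat.zero_le _
      · intro d hd
        have : d ≠ c := fun e => hc (e ▸ hd)
        simp [this]

/-- If regular sequences of length `d` exist for `S/J`, they exist for `S/(J ∩ P)`. -/
lemma exists_regular_inf (hab : G.Adj a b)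
    (htri : ∀ c : Fin n, c ≠ a → c ≠ b → ¬ (G.Adj a c ∧ G.Adj b c)) (d : ℕ)
    (h : ∃ rs : List (MvPolynomial (Fin n) K), rs.length = d ∧
      (∀ r ∈ rs, r ∈ irrelevantIdeal K (Fin n)) ∧
      IsRegular (MvPolynomial (Fin n) K ⧸ alexDual (edgeIdeal K Gᶜ)) rs) :
    ∃ rs : List (MvPolynomial (Fin n) K), rs.length = d ∧
      (∀ r ∈ rs, r ∈ irrelevantIdeal K (Fin n)) ∧
      IsRegular (MvPolynomial (Fin n) K ⧸ (alexDual (edgeIdeal K Gᶜ) ⊓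
        Ideal.span ((X : _ → MvPolynomial (Fin n) K) '' {a, b}))) rs := by
  classical
  obtain ⟨E, hE, hEJ⟩ := alexDual_eq_inf (K := K) Gᶜ
  have hwm := wprod_mem (K := K) G a b hab
  have hdec := fun f => decomp (K := K) G a b htri (f := f)
  set J := alexDual (edgeIdeal K Gᶜ) with hJdef
  set P := Ideal.span ((X : _ → MvPolynomial (Fin n) K) '' {a, b}) with hPdef
  set m := irrelevantIdeal K (Fin n) with hmdef
  -- the bound `d ≤ n - 2`
  have hd : d ≤ n - 2 := by
    obtain ⟨rs, rfl, _, hreg⟩ := h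
    have h1 := length_le_supportDim _ _ hreg
    rw [hEJ] at h1
    exact_mod_cast h1.trans (supportDim_inf E hE)
  have hPm : P ≤ m := span_X_le _
  have hJm : J ≤ m := by
    obtain ⟨rs, _, _, hreg⟩ := h
    have hnt := hreg.nontrivial
    have hJtop : J ≠ ⊤ := Ideal.Quotient.nontrivial_iff.mp hnt
    have hne : E.Nonempty := by
      rw [Finset.nonempty_iff_ne_empty]
      rintro rfl
      exact hJtop (by rw [hEJ]; simp)
    obtain ⟨e, he⟩ := hne
    rw [hEJ]
    exact (Finset.inf_le he).trans (span_X_le _)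
  have hm : m ≠ ⊤ := irrelevant_ne_top
  -- the short exact sequence
  let w := wprod K a b
  let f₀ : MvPolynomial (Fin n) K →ₗ[MvPolynomial (Fin n) K] MvPolynomial (Fin n) K :=
    LinearMap.lsmul _ _ w
  have hwP : ∀ f, w * f ∈ P → f ∈ P := by
    intro f hf
    exact prod_mul_mem _ (by simp; tauto) hf
  let f : (MvPolynomial (Fin n) K ⧸ P) →ₗ[MvPolynomial (Fin n) K]
      (MvPolynomial (Fin n) K ⧸ (J ⊓ P)) :=
    Submodule.mapQ P (J ⊓ P) f₀ (fun x hx => ⟨J.mul_mem_right x hwm, P.mul_mem_left w hx⟩)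
  let g : (MvPolynomial (Fin n) K ⧸ (J ⊓ P)) →ₗ[MvPolynomial (Fin n) K]
      (MvPolynomial (Fin n) K ⧸ J) :=
    Submodule.mapQ (J ⊓ P) J LinearMap.id (fun x hx => hx.1)
  refine exists_regular_middle m d (smul_top_lt hm hPm) (smul_top_lt hm (inf_le_left.trans hJm))
    (smul_top_lt hm hJm) f g ?_ ?_ ?_ ?_ h
  · rw [injective_iff_map_eq_zero]
    intro x hx
    obtain ⟨x, rfl⟩ := Submodule.mkQ_surjective _ x
    have hx' : w * x ∈ J ⊓ P := (Submodule.Quotient.mk_eq_zero _).mp hx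
    exact (Submodule.Quotient.mk_eq_zero _).mpr (hwP x hx'.2)
  · intro y
    obtain ⟨y, rfl⟩ := Submodule.mkQ_surjective _ y
    exact ⟨Submodule.Quotient.mk y, rfl⟩
  · intro y
    obtain ⟨y, rfl⟩ := Submodule.mkQ_surjective _ y
    constructor
    · intro hy
      have hy' : y ∈ J := (Submodule.Quotient.mk_eq_zero _).mp hy
      obtain ⟨t, ht⟩ := hdec y hy'
      refine ⟨Submodule.Quotient.mk t, ?_⟩
      refine Eq.symm ((Submodule.Quotient.eq _).mpr ?_)
      exact ⟨J.sub_mem hy' (J.mul_mem_right t hwm), ht⟩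
    · rintro ⟨t, ht⟩
      obtain ⟨t, rfl⟩ := Submodule.mkQ_surjective _ t
      rw [← ht]
      exact (Submodule.Quotient.mk_eq_zero _).mpr (J.mul_mem_right t hwm)
  · -- regular sequence on `S/P`
    let l := ((Finset.univ.erase a).erase b).toList
    have hl : ([a, b] ++ l).Nodup := by
      simp [l, hab.ne, Finset.nodup_toList]
    have hreg := regular_rest (K := K) [a, b] l hl
    have hs : ({k | k ∈ [a, b]} : Set (Fin n)) = {a, b} := by ext; simp
    rw [hs] at hreg
    have hlen : l.length = n - 2 := by
      simp only [l, Finset.length_toList]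
      rw [Finset.card_erase_of_mem (by simp [hab.ne.symm]), Finset.card_erase_of_mem (by simp)]
      simp
      omega
    have hwr := hreg.toIsWeaklyRegular
    rw [← List.take_append_drop d (l.map X), isWeaklyRegular_append_iff] at hwr
    have hmem : ∀ r ∈ (l.map (X : _ → MvPolynomial (Fin n) K)).take d, r ∈ m := by
      intro r hr
      obtain ⟨i, _, rfl⟩ := List.mem_map.mp (List.mem_of_mem_take hr)
      exact Ideal.subset_span ⟨i, rfl⟩
    refine ⟨(l.map X).take d, ?_, hmem, top_ne_of_le hm hPm hmem hwr.1⟩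
    simp [hlen, hd]

end main

end Stmt13Aux

/-- if `{a,b} ∈ E(G)` and no other vertex is adjacent to both `a` and
`b`, then for `I = I(Ḡ)`: `depth S/(I^∨ ∩ (x_a, x_b)) ≥ depth S/I^∨`. -/
theorem stmt13 (K : Type) [Field K] (n : ℕ) (G : SimpleGraph (Fin n)) (a b : Fin n)
    (hab : G.Adj a b)
    (htri : ∀ c : Fin n, c ≠ a → c ≠ b → ¬ (G.Adj a c ∧ G.Adj b c)) :
    depthIdeal (irrelevantIdeal K (Fin n))
      (MvPolynomial (Fin n) K ⧸
        (alexDual (edgeIdeal K Gᶜ) ⊓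
          Ideal.span {(X a : MvPolynomial (Fin n) K), X b})) ≥
    depthIdeal (irrelevantIdeal K (Fin n))
      (MvPolynomial (Fin n) K ⧸ alexDual (edgeIdeal K Gᶜ)) := by
  classical
  have hP : Ideal.span {(X a : MvPolynomial (Fin n) K), X b} =
      Ideal.span ((X : _ → MvPolynomial (Fin n) K) '' {a, b}) := by
    rw [Set.image_pair]
  rw [hP]
  unfold depthIdeal
  set S₁ := {k | ∃ rs : List (MvPolynomial (Fin n) K), rs.length = k ∧
    (∀ r ∈ rs, r ∈ irrelevantIdeal K (Fin n)) ∧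
    RingTheory.Sequence.IsRegular (MvPolynomial (Fin n) K ⧸ alexDual (edgeIdeal K Gᶜ)) rs}
    with hS₁
  by_cases hS : S₁.Nonempty ∧ BddAbove S₁
  · have hmem := Nat.sSup_mem hS.1 hS.2
    refine le_csSup ?_ (Stmt13Aux.exists_regular_inf G a b hab htri _ hmem)
    refine ⟨n, ?_⟩
    rintro k ⟨rs, rfl, _, hreg⟩
    have h1 := (Stmt13Aux.length_le_supportDim _ _ hreg).trans
      (Module.supportDim_le_ringKrullDim _ _)
    rw [MvPolynomial.ringKrullDim_of_isNoetherianRing, ringKrullDim_eq_zero_of_field] at h1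
    simp only [zero_add, Nat.card_fin] at h1
    exact_mod_cast h1
  · have h0 : sSup S₁ = 0 := by
      rw [not_and_or] at hS
      rcases hS with h | h
      · rw [Set.not_nonempty_iff_eq_empty.mp h]; simp
      · exact Nat.sSup_of_not_bddAbove h
    rw [h0]
    exact Nat.zero_le _
end

section
/- Let C be a cycle of length n > 3 and I = I(C̄) ⊂ K[x_1,…,x_n] the edge ideal of its complement. Then reg(I) = 3; in particular I does not have a linear resolution. -/
open MvPolynomial

noncomputable section

namespace Cyc

variable {K : Type} [Field K] {σ : Type}

/-- homogeneous elements of degree `e` in a graded free module -/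
def HomE {ι : Type} (deg : ι → ℕ) (e : ℕ) (x : ι →₀ MvPolynomial σ K) : Prop :=
  ∀ c α, coeff α (x c) ≠ 0 → α.degree + deg c = e

/-- projection of a polynomial to degree `e` with shift `k` -/
def pj (k e : ℕ) (p : MvPolynomial σ K) : MvPolynomial σ K :=
  if k ≤ e then homogeneousComponent (e - k) p else 0

lemma coeff_pj (k e : ℕ) (p : MvPolynomial σ K) (α : σ →₀ ℕ) :
    coeff α (pj k e p) = if α.degree + k = e then coeff α p else 0 := by
  unfold pj
  by_cases h : k ≤ e
  · rw [if_pos h, coeff_homogeneousComponent]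
    congr 1
    apply propext
    constructor <;> intro h' <;> omega
  · rw [if_neg h, if_neg (by omega), coeff_zero]

@[simp] lemma pj_zero (k e : ℕ) : pj k e (0 : MvPolynomial σ K) = 0 := by
  ext α; simp [coeff_pj]

/-- homogeneous component in a graded free module -/
def comp {ι : Type} (deg : ι → ℕ) (e : ℕ) (x : ι →₀ MvPolynomial σ K) :
    ι →₀ MvPolynomial σ K :=
  Finsupp.onFinset x.support (fun c => pj (deg c) e (x c)) (by
    intro c hc
    rw [Finsupp.mem_support_iff]
    intro h
    apply hc
    rw [h, pj_zero])

@[simp] lemma comp_apply {ι : Type} (deg : ι → ℕ) (e : ℕ) (x : ι →₀ MvPolynomial σ K) (c : ι) :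
    comp deg e x c = pj (deg c) e (x c) := rfl

lemma comp_homE {ι : Type} (deg : ι → ℕ) (e : ℕ) (x : ι →₀ MvPolynomial σ K) :
    HomE deg e (comp deg e x) := by
  intro c α h
  rw [comp_apply, coeff_pj] at h
  by_contra h'
  exact h (if_neg h')

lemma comp_of_homE {ι : Type} {deg : ι → ℕ} {e : ℕ} {x : ι →₀ MvPolynomial σ K}
    (h : HomE deg e x) : comp deg e x = x := by
  ext c α
  rw [comp_apply, coeff_pj]
  split_ifs with h'
  · rfl
  · by_contra h''
    exact h' (h c α (Ne.symm h''))

lemma comp_add {ι : Type} (deg : ι → ℕ) (e : ℕ) (x y : ι →₀ MvPolynomial σ K) :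
    comp deg e (x + y) = comp deg e x + comp deg e y := by
  ext c α
  simp only [comp_apply, Finsupp.add_apply, coeff_add, coeff_pj]
  split_ifs <;> simp

lemma comp_zero {ι : Type} (deg : ι → ℕ) (e : ℕ) :
    comp deg e (0 : ι →₀ MvPolynomial σ K) = 0 := by
  ext c α
  simp

lemma comp_smul {ι : Type} {deg : ι → ℕ} {k : ℕ} (e : ℕ) (p : MvPolynomial σ K)
    {v : ι →₀ MvPolynomial σ K} (h : HomE deg k v) :
    comp deg e (p • v) = pj k e p • v := by
  classical
  ext c α
  simp only [comp_apply, Finsupp.smul_apply, smul_eq_mul, coeff_pj, coeff_mul]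
  split_ifs with h1
  · refine Finset.sum_congr rfl fun x hx => ?_
    rw [Finset.HasAntidiagonal.mem_antidiagonal] at hx
    split_ifs with h2
    · rfl
    · rw [zero_mul]
      by_contra h3
      have := h c x.2 (right_ne_zero_of_mul h3)
      rw [← hx, map_add] at h1
      omega
  · symm
    refine Finset.sum_eq_zero fun x hx => ?_
    rw [Finset.HasAntidiagonal.mem_antidiagonal] at hx
    split_ifs with h2
    · by_contra h3
      have := h c x.2 (right_ne_zero_of_mul h3)
      rw [← hx, map_add] at h1
      omega
    · rw [zero_mul]

lemma comp_single {ι : Type} (deg : ι → ℕ) (e : ℕ) (b : ι) (p : MvPolynomial σ K) :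
    comp deg e (Finsupp.single b p) = Finsupp.single b (pj (deg b) e p) := by
  classical
  ext c α
  rw [comp_apply]
  by_cases h : b = c
  · subst h; simp
  · simp [Finsupp.single_eq_of_ne' h]

lemma map_single {ι M : Type} [AddCommGroup M] [Module (MvPolynomial σ K) M]
    (D : (ι →₀ MvPolynomial σ K) →ₗ[MvPolynomial σ K] M) (b : ι) (p : MvPolynomial σ K) :
    D (Finsupp.single b p) = p • D (Finsupp.single b 1) := by
  rw [← map_smul, Finsupp.smul_single, smul_eq_mul, mul_one]

/-- homogeneous maps, with degree shift `s` -/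
def HomM {ι κ : Type} (dι : ι → ℕ) (dκ : κ → ℕ) (s : ℕ)
    (D : (ι →₀ MvPolynomial σ K) →ₗ[MvPolynomial σ K] (κ →₀ MvPolynomial σ K)) : Prop :=
  ∀ b, HomE dκ (dι b + s) (D (Finsupp.single b 1))

lemma comp_map {ι κ : Type} {dι : ι → ℕ} {dκ : κ → ℕ}
    {D : (ι →₀ MvPolynomial σ K) →ₗ[MvPolynomial σ K] (κ →₀ MvPolynomial σ K)}
    (h : HomM dι dκ 0 D) (e : ℕ) (x : ι →₀ MvPolynomial σ K) :
    comp dκ e (D x) = D (comp dι e x) := by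
  induction x using Finsupp.induction_linear with
  | zero => simp [comp_zero]
  | add x y hx hy => simp only [map_add, comp_add, hx, hy]
  | single b p =>
    rw [map_single, comp_smul e p (h b), comp_single, map_single D b (pj _ _ _)]
    rfl

lemma homE_smul {ι : Type} {deg : ι → ℕ} {k l e : ℕ} {p : MvPolynomial σ K}
    {v : ι →₀ MvPolynomial σ K} (hp : ∀ α, coeff α p ≠ 0 → α.degree + k = l)
    (h : HomE deg e v) : ∀ c α, coeff α ((p • v) c) ≠ 0 → α.degree + deg c + k = e + l := by
  classical
  intro c α hα
  rw [Finsupp.smul_apply, smul_eq_mul, coeff_mul] at hα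
  obtain ⟨⟨β, γ⟩, hm, hne⟩ := Finset.exists_ne_zero_of_sum_ne_zero hα
  rw [Finset.HasAntidiagonal.mem_antidiagonal] at hm
  simp only at hm hne
  have h1 := hp β (left_ne_zero_of_mul hne)
  have h2 := h c γ (right_ne_zero_of_mul hne)
  rw [← hm, map_add]
  omega

lemma homE_map {ι κ : Type} {dι : ι → ℕ} {dκ : κ → ℕ} {s e : ℕ}
    {D : (ι →₀ MvPolynomial σ K) →ₗ[MvPolynomial σ K] (κ →₀ MvPolynomial σ K)}
    (h : HomM dι dκ s D) {x : ι →₀ MvPolynomial σ K} (hx : HomE dι e x) :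
    HomE dκ (e + s) (D x) := by
  classical
  intro c α hα
  have hx' : x = ∑ b ∈ x.support, Finsupp.single b (x b) := (Finsupp.sum_single x).symm
  rw [hx', map_sum, Finsupp.finsetSum_apply, coeff_sum] at hα
  obtain ⟨b, _, hne⟩ := Finset.exists_ne_zero_of_sum_ne_zero hα
  rw [map_single] at hne
  have := homE_smul (hx b) (h b) c α hne
  omega

/-- homogeneous preimages -/
lemma exists_hom_preimage {ι κ : Type} {dι : ι → ℕ} {dκ : κ → ℕ}
    {D : (ι →₀ MvPolynomial σ K) →ₗ[MvPolynomial σ K] (κ →₀ MvPolynomial σ K)}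
    (h : HomM dι dκ 0 D) {e : ℕ} {y : κ →₀ MvPolynomial σ K} (hy : HomE dκ e y)
    (hr : y ∈ LinearMap.range D) : ∃ x, HomE dι e x ∧ D x = y := by
  obtain ⟨x, rfl⟩ := hr
  exact ⟨comp dι e x, comp_homE _ _ _, by rw [← comp_map h, comp_of_homE hy]⟩

/-- free modules are projective -/
lemma exists_lift {ι M N : Type} [AddCommGroup M] [Module (MvPolynomial σ K) M]
    [AddCommGroup N] [Module (MvPolynomial σ K) N]
    (D : M →ₗ[MvPolynomial σ K] N) (ψ : (ι →₀ MvPolynomial σ K) →ₗ[MvPolynomial σ K] N)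
    (P : ι → M → Prop)
    (h : ∀ b, ∃ x, P b x ∧ D x = ψ (Finsupp.single b 1)) :
    ∃ f : (ι →₀ MvPolynomial σ K) →ₗ[MvPolynomial σ K] M,
      (∀ b, P b (f (Finsupp.single b 1))) ∧ ∀ x, D (f x) = ψ x := by
  choose v hv hD using h
  refine ⟨Finsupp.linearCombination _ v, fun b => by simpa using hv b, fun x => ?_⟩
  have : D ∘ₗ Finsupp.linearCombination _ v = ψ := by
    ext b
    simp [hD]
  exact LinearMap.congr_fun this x

end Cyc

end

noncomputable section

namespace Cyc

variable {K : Type} [Field K] {σ : Type}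

/-- A graded free resolution of a cyclic module: `⋯ → F₂ → F₁ → F₀ = S`, exact in positive degrees. -/
structure GC (K : Type) [Field K] (σ : Type) where
  ι : ℕ → Type
  deg : ∀ i, ι i → ℕ
  d : ∀ i, (ι (i + 1) →₀ MvPolynomial σ K) →ₗ[MvPolynomial σ K] (ι i →₀ MvPolynomial σ K)
  exact : ∀ i, LinearMap.ker (d i) = LinearMap.range (d (i + 1))
  hom : ∀ i, HomM (deg (i + 1)) (deg i) 0 (d i)
  u : ι 0
  uniq : ∀ c, c = u
  deg_u : deg 0 u = 0

/-- `X` resolves `S / J` -/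
def GC.Res (X : GC K σ) (J : Ideal (MvPolynomial σ K)) : Prop :=
  ∀ x, x ∈ LinearMap.range (X.d 0) ↔ x X.u ∈ J

lemma GC.single_u (X : GC K σ) (x : X.ι 0 →₀ MvPolynomial σ K) :
    x = Finsupp.single X.u (x X.u) := by
  ext c
  rw [X.uniq c]
  simp

lemma GC.dd (X : GC K σ) (i : ℕ) (x) : X.d i (X.d (i + 1) x) = 0 := by
  have : X.d (i + 1) x ∈ LinearMap.ker (X.d i) := by
    rw [X.exact]; exact ⟨x, rfl⟩
  exact this

lemma GC.exists_of_ker (X : GC K σ) (i : ℕ) (x) (h : X.d i x = 0) : ∃ y, X.d (i + 1) y = x := by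
  have : x ∈ LinearMap.ker (X.d i) := h
  rw [X.exact] at this
  exact this

/-- graded chain maps lifting multiplication by `m` -/
theorem exists_chain (X Y : GC K σ) {J J' : Ideal (MvPolynomial σ K)} (hX : X.Res J)
    (hY : Y.Res J') (m : MvPolynomial σ K) (s : ℕ) (hm : ∀ α, coeff α m ≠ 0 → α.degree = s)
    (h : ∀ p ∈ J, p * m ∈ J') :
    ∃ f : ∀ i, (X.ι i →₀ MvPolynomial σ K) →ₗ[MvPolynomial σ K] (Y.ι i →₀ MvPolynomial σ K),
      (∀ x, (f 0 x) Y.u = x X.u * m) ∧ (∀ i x, Y.d i (f (i + 1) x) = f i (X.d i x)) ∧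
      ∀ i, HomM (X.deg i) (Y.deg i) s (f i) := by
  let T : ℕ → Type := fun i =>
    {f : (X.ι i →₀ MvPolynomial σ K) →ₗ[MvPolynomial σ K] (Y.ι i →₀ MvPolynomial σ K) //
      HomM (X.deg i) (Y.deg i) s f ∧ ∀ x, f (X.d i x) ∈ LinearMap.range (Y.d i)}
  have step : ∀ i (f : T i), ∃ g : T (i + 1), ∀ x, Y.d i (g.1 x) = f.1 (X.d i x) := by
    intro i f
    obtain ⟨g, hg, hg'⟩ := exists_lift (Y.d i) (f.1 ∘ₗ X.d i)
      (fun b x => HomE (Y.deg (i + 1)) (X.deg (i + 1) b + s) x) (by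
        intro b
        exact exists_hom_preimage (Y.hom i) (homE_map f.2.1 (X.hom i b)) (f.2.2 _))
    refine ⟨⟨g, hg, fun x => ?_⟩, hg'⟩
    rw [← Y.exact, LinearMap.mem_ker, hg']
    simp [X.dd]
  choose next hnext using step
  have hf0 : ∀ x : X.ι 0 →₀ MvPolynomial σ K,
      (Finsupp.linearCombination (MvPolynomial σ K) (fun _ : X.ι 0 => Finsupp.single Y.u m) x) Y.u
        = x X.u * m := by
    intro x
    conv_lhs => rw [X.single_u x]
    simp
  let f0 : T 0 := ⟨Finsupp.linearCombination _ (fun _ => Finsupp.single Y.u m), by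
    constructor
    · intro b c α hα
      rw [Y.uniq c] at hα ⊢
      rw [X.uniq b] at hα ⊢
      rw [hf0] at hα
      simp only [Finsupp.single_eq_same, one_mul] at hα
      rw [hm α hα, Y.deg_u, X.deg_u]; ring
    · intro x
      rw [hY, hf0]
      exact h _ ((hX _).1 ⟨x, rfl⟩)⟩
  let F : ∀ i, T i := fun i => Nat.rec (motive := T) f0 next i
  exact ⟨fun i => (F i).1, hf0, fun i x => hnext i (F i) x, fun i => (F i).2.1⟩

/-- homotopy -/
theorem exists_homotopy (X : GC K σ)
    (θ : ∀ i, (X.ι i →₀ MvPolynomial σ K) →ₗ[MvPolynomial σ K] (X.ι i →₀ MvPolynomial σ K))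
    (h0 : ∀ x, θ 0 x = 0) (hθ : ∀ i x, X.d i (θ (i + 1) x) = θ i (X.d i x)) (i : ℕ) :
    ∃ h : (X.ι i →₀ MvPolynomial σ K) →ₗ[MvPolynomial σ K] (X.ι (i + 1) →₀ MvPolynomial σ K),
    ∃ h' : (X.ι (i + 1) →₀ MvPolynomial σ K) →ₗ[MvPolynomial σ K]
        (X.ι (i + 1 + 1) →₀ MvPolynomial σ K),
      ∀ x, θ (i + 1) x = X.d (i + 1) (h' x) + h (X.d i x) := by
  have next : ∀ i (h : (X.ι i →₀ MvPolynomial σ K) →ₗ[MvPolynomial σ K]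
      (X.ι (i + 1) →₀ MvPolynomial σ K)), (∀ x, X.d i (θ (i + 1) x - h (X.d i x)) = 0) →
      ∃ h' : (X.ι (i + 1) →₀ MvPolynomial σ K) →ₗ[MvPolynomial σ K]
        (X.ι (i + 1 + 1) →₀ MvPolynomial σ K),
        ∀ x, X.d (i + 1) (h' x) = θ (i + 1) x - h (X.d i x) := by
    intro i h hh
    obtain ⟨h', _, hh'⟩ := exists_lift (X.d (i + 1)) (θ (i + 1) - h ∘ₗ X.d i) (fun _ _ => True)
      (fun b => by
        obtain ⟨y, hy⟩ := X.exists_of_ker i _ (hh (Finsupp.single b 1))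
        exact ⟨y, trivial, hy⟩)
    exact ⟨h', hh'⟩
  have key : ∀ i, ∃ h : (X.ι i →₀ MvPolynomial σ K) →ₗ[MvPolynomial σ K]
      (X.ι (i + 1) →₀ MvPolynomial σ K), ∀ x, X.d i (θ (i + 1) x - h (X.d i x)) = 0 := by
    intro i
    induction i with
    | zero => exact ⟨0, fun x => by simp [hθ, h0]⟩
    | succ i ih =>
      obtain ⟨h, hh⟩ := ih
      obtain ⟨h', hh'⟩ := next i h hh
      refine ⟨h', fun x => ?_⟩
      rw [map_sub, hθ, hh', X.dd, map_zero, sub_zero, sub_self]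
  obtain ⟨h, hh⟩ := key i
  obtain ⟨h', hh'⟩ := next i h hh
  exact ⟨h, h', fun x => by rw [hh']; abel⟩

/-- constant coefficients of a map applied to an element -/
lemma constCoeff_map {ι κ : Type}
    (D : (ι →₀ MvPolynomial σ K) →ₗ[MvPolynomial σ K] (κ →₀ MvPolynomial σ K))
    (x : ι →₀ MvPolynomial σ K) (c : κ) :
    constantCoeff (D x c) =
      x.sum (fun b p => constantCoeff p * constantCoeff (D (Finsupp.single b 1) c)) := by
  conv_lhs => rw [← Finsupp.sum_single x]
  rw [Finsupp.sum, map_sum, Finsupp.finsetSum_apply, map_sum, Finsupp.sum]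
  refine Finset.sum_congr rfl fun b _ => ?_
  rw [map_single, Finsupp.smul_apply, smul_eq_mul, map_mul]

lemma constCoeff_hom {ι κ : Type} {dι : ι → ℕ} {dκ : κ → ℕ} {s : ℕ}
    {D : (ι →₀ MvPolynomial σ K) →ₗ[MvPolynomial σ K] (κ →₀ MvPolynomial σ K)}
    (h : HomM dι dκ s D) (b : ι) (c : κ) (hne : dκ c ≠ dι b + s) :
    constantCoeff (D (Finsupp.single b 1) c) = 0 := by
  by_contra h'
  rw [constantCoeff_eq] at h'
  have := h b c 0 h'
  simp at this
  exact hne this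

/-- Comparison of resolutions. -/
theorem rigidity (X Y : GC K σ) {J : Ideal (MvPolynomial σ K)} (hX : X.Res J) (hY : Y.Res J)
    (i j : ℕ)
    (h1 : ∀ (e : X.ι (i + 1)) (c : X.ι (i + 1 + 1)), X.deg _ e = j →
      constantCoeff (X.d (i + 1) (Finsupp.single c 1) e) = 0)
    (h2 : ∀ (e : X.ι (i + 1)) (c : X.ι i), X.deg _ e = j →
      constantCoeff (X.d i (Finsupp.single e 1) c) = 0) :
    Nonempty ({e : X.ι (i + 1) // X.deg _ e = j} ↪ {e : Y.ι (i + 1) // Y.deg _ e = j}) := by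
  classical
  obtain ⟨g, g0, gd, gh⟩ := exists_chain X Y hX hY 1 0
    (fun α hα => by
      rw [coeff_one] at hα
      split_ifs at hα with h
      · rw [← h]; simp
      · simp at hα) (by simp)
  obtain ⟨f, f0, fd, fh⟩ := exists_chain Y X hY hX 1 0
    (fun α hα => by
      rw [coeff_one] at hα
      split_ifs at hα with h
      · rw [← h]; simp
      · simp at hα) (by simp)
  obtain ⟨h, h', hh⟩ := exists_homotopy X (fun i => f i ∘ₗ g i - LinearMap.id)
    (fun x => by
      ext1 c
      rw [X.uniq c]
      simp [f0, g0])
    (fun i x => by simp [fd, gd]) i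
  -- matrices over `K`
  let G : X.ι (i + 1) → Y.ι (i + 1) → K := fun e b =>
    constantCoeff (g (i + 1) (Finsupp.single e 1) b)
  let F : Y.ι (i + 1) → X.ι (i + 1) → K := fun b e =>
    constantCoeff (f (i + 1) (Finsupp.single b 1) e)
  have key : ∀ e e' : X.ι (i + 1), X.deg _ e = j → X.deg _ e' = j →
      constantCoeff (f (i + 1) (g (i + 1) (Finsupp.single e 1)) e') = if e = e' then 1 else 0 := by
    intro e e' he he'
    have := congrArg (fun y => constantCoeff (y e')) (hh (Finsupp.single e 1))
    simp only [LinearMap.sub_apply, LinearMap.comp_apply, LinearMap.id_apply, Finsupp.sub_apply,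
      Finsupp.add_apply, map_sub, map_add] at this
    rw [constCoeff_map (X.d (i + 1)), constCoeff_map h] at this
    have z1 : ((h' (Finsupp.single e 1)).sum fun b p =>
        constantCoeff p * constantCoeff (X.d (i + 1) (Finsupp.single b 1) e')) = 0 := by
      refine Finset.sum_eq_zero fun b _ => ?_
      simp only [h1 e' b he', mul_zero]
    have z2 : ((X.d i (Finsupp.single e 1)).sum fun b p =>
        constantCoeff p * constantCoeff (h (Finsupp.single b 1) e')) = 0 := by
      refine Finset.sum_eq_zero fun b _ => ?_
      simp only [h2 e b he, zero_mul]
    rw [z1, z2, add_zero, sub_eq_zero] at this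
    rw [this, Finsupp.single_apply]
    split_ifs <;> simp
  -- the linear map
  let v : {e : X.ι (i + 1) // X.deg _ e = j} → ({e : Y.ι (i + 1) // Y.deg _ e = j} →₀ K) :=
    fun e => Finsupp.comapDomain Subtype.val
      (Finsupp.mapRange constantCoeff (map_zero _) (g (i + 1) (Finsupp.single e.1 1)))
      (Subtype.val_injective.injOn)
  let w : {e : Y.ι (i + 1) // Y.deg _ e = j} → ({e : X.ι (i + 1) // X.deg _ e = j} →₀ K) :=
    fun e => Finsupp.comapDomain Subtype.val
      (Finsupp.mapRange constantCoeff (map_zero _) (f (i + 1) (Finsupp.single e.1 1)))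
      (Subtype.val_injective.injOn)
  have hwv : (Finsupp.linearCombination K w) ∘ₗ (Finsupp.linearCombination K v) =
      LinearMap.id := by
    ext e e'
    have k := key e.1 e'.1 e.2 e'.2
    rw [constCoeff_map] at k
    simp only [LinearMap.comp_apply, Finsupp.lsingle_apply, Finsupp.linearCombination_single,
      one_smul, LinearMap.id_apply]
    rw [Finsupp.linearCombination_apply, Finsupp.sum, Finsupp.finsetSum_apply]
    rw [Finsupp.single_apply]
    simp only [Subtype.ext_iff]
    rw [← k, Finsupp.sum]
    have : ∀ b ∈ (g (i + 1) (Finsupp.single e.1 1)).support,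
        b ∉ (v e).support.map ⟨Subtype.val, Subtype.val_injective⟩ →
        constantCoeff (g (i + 1) (Finsupp.single e.1 1) b) *
          constantCoeff (f (i + 1) (Finsupp.single b 1) e'.1) = 0 := by
      intro b _ hb
      by_cases hbj : Y.deg _ b = j
      · have : v e ⟨b, hbj⟩ = 0 := by
          by_contra hne
          apply hb
          rw [Finset.mem_map]
          exact ⟨⟨b, hbj⟩, Finsupp.mem_support_iff.2 hne, rfl⟩
        have h3 : constantCoeff (g (i + 1) (Finsupp.single e.1 1) b) = 0 := this
        rw [h3, zero_mul]
      · rw [constCoeff_hom (gh (i + 1)) e.1 b (by rw [e.2]; exact hbj), zero_mul]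
    rw [← Finset.sum_subset _ this, Finset.sum_map]
    · rfl
    · intro b hb
      rw [Finset.mem_map] at hb
      obtain ⟨a, ha, rfl⟩ := hb
      rw [Finsupp.mem_support_iff] at ha ⊢
      intro h3
      apply ha
      change constantCoeff (g (i + 1) (Finsupp.single e.1 1) a.1) = 0
      have h3' : g (i + 1) (Finsupp.single e.1 1) a.1 = 0 := h3
      rw [h3', map_zero]
  have inj : Function.Injective (Finsupp.linearCombination K v) := by
    intro x y hxy
    have := congrArg (Finsupp.linearCombination K w) hxy
    rwa [← LinearMap.comp_apply, ← LinearMap.comp_apply, hwv] at this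
  have := LinearMap.rank_le_of_injective _ inj
  rw [rank_finsupp_self', rank_finsupp_self'] at this
  exact this

end Cyc

end

noncomputable section

namespace Cyc

variable {K : Type} [Field K] {σ : Type}

/-- basis of the mapping cone -/
def coneι (A B : GC K σ) : ℕ → Type
  | 0 => A.ι 0
  | i + 1 => A.ι (i + 1) ⊕ B.ι i

/-- degrees of the basis of the mapping cone -/
def coneDeg (A B : GC K σ) (s : ℕ) : ∀ i, coneι A B i → ℕ
  | 0 => A.deg 0
  | i + 1 => Sum.elim (A.deg (i + 1)) (fun b => B.deg i b + s)

/-- first injection -/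
def jA (A B : GC K σ) (i : ℕ) : A.ι (i + 1) → coneι A B (i + 1) := Sum.inl

/-- second injection -/
def jB (A B : GC K σ) (i : ℕ) : B.ι i → coneι A B (i + 1) := Sum.inr

lemma jA_inj (A B : GC K σ) (i : ℕ) : Function.Injective (jA A B i) := Sum.inl_injective

lemma jB_inj (A B : GC K σ) (i : ℕ) : Function.Injective (jB A B i) := Sum.inr_injective

lemma j_cases (A B : GC K σ) (i : ℕ) (c : coneι A B (i + 1)) :
    (∃ a, c = jA A B i a) ∨ ∃ b, c = jB A B i b := by
  rcases c with a | b
  · exact Or.inl ⟨a, rfl⟩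
  · exact Or.inr ⟨b, rfl⟩

lemma jA_ne_jB (A B : GC K σ) (i : ℕ) (a b) : jA A B i a ≠ jB A B i b := Sum.inl_ne_inr

/-- inclusion of the first summand -/
def inA (A B : GC K σ) (i : ℕ) : (A.ι (i + 1) →₀ MvPolynomial σ K) →ₗ[MvPolynomial σ K]
    (coneι A B (i + 1) →₀ MvPolynomial σ K) :=
  Finsupp.lmapDomain _ _ (jA A B i)

/-- inclusion of the second summand -/
def inB (A B : GC K σ) (i : ℕ) : (B.ι i →₀ MvPolynomial σ K) →ₗ[MvPolynomial σ K]
    (coneι A B (i + 1) →₀ MvPolynomial σ K) :=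
  Finsupp.lmapDomain _ _ (jB A B i)

lemma inA_single (A B : GC K σ) (i : ℕ) (a p) :
    inA A B i (Finsupp.single a p) = Finsupp.single (jA A B i a) p :=
  Finsupp.mapDomain_single

lemma inB_single (A B : GC K σ) (i : ℕ) (a p) :
    inB A B i (Finsupp.single a p) = Finsupp.single (jB A B i a) p :=
  Finsupp.mapDomain_single

lemma inA_inl (A B : GC K σ) (i : ℕ) (x) (c) : inA A B i x (jA A B i c) = x c :=
  Finsupp.mapDomain_apply (jA_inj A B i) _ _

lemma inA_inr (A B : GC K σ) (i : ℕ) (x) (c) : inA A B i x (jB A B i c) = 0 :=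
  Finsupp.mapDomain_of_notMem_range _ _ (by rintro ⟨a, ha⟩; exact jA_ne_jB A B i a c ha)

lemma inB_inr (A B : GC K σ) (i : ℕ) (x) (c) : inB A B i x (jB A B i c) = x c :=
  Finsupp.mapDomain_apply (jB_inj A B i) _ _

lemma inB_inl (A B : GC K σ) (i : ℕ) (x) (c) : inB A B i x (jA A B i c) = 0 :=
  Finsupp.mapDomain_of_notMem_range _ _ (by rintro ⟨a, ha⟩; exact jA_ne_jB A B i c a ha.symm)

lemma exists_in (A B : GC K σ) (i : ℕ) (x : coneι A B (i + 1) →₀ MvPolynomial σ K) :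
    ∃ a b, x = inA A B i a + inB A B i b := by
  refine ⟨Finsupp.comapDomain (jA A B i) x (jA_inj A B i).injOn,
    Finsupp.comapDomain (jB A B i) x (jB_inj A B i).injOn, ?_⟩
  ext1 c
  obtain ⟨c, rfl⟩ | ⟨c, rfl⟩ := j_cases A B i c
  · rw [Finsupp.add_apply, inA_inl, inB_inl, add_zero]; rfl
  · rw [Finsupp.add_apply, inA_inr, inB_inr, zero_add]; rfl

lemma in_inj (A B : GC K σ) (i : ℕ) {a a' b b'}
    (h : inA A B i a + inB A B i b = inA A B i a' + inB A B i b') : a = a' ∧ b = b' := by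
  constructor
  · ext1 c
    have := DFunLike.congr_fun h (jA A B i c)
    rwa [Finsupp.add_apply, Finsupp.add_apply, inA_inl, inB_inl, inA_inl, inB_inl, add_zero,
      add_zero] at this
  · ext1 c
    have := DFunLike.congr_fun h (jB A B i c)
    rwa [Finsupp.add_apply, Finsupp.add_apply, inA_inr, inB_inr, inA_inr, inB_inr, zero_add,
      zero_add] at this

/-- differential of the mapping cone -/
def coneD (A B : GC K σ)
    (φ : ∀ i, (B.ι i →₀ MvPolynomial σ K) →ₗ[MvPolynomial σ K] (A.ι i →₀ MvPolynomial σ K)) :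
    ∀ i, (coneι A B (i + 1) →₀ MvPolynomial σ K) →ₗ[MvPolynomial σ K]
      (coneι A B i →₀ MvPolynomial σ K)
  | 0 => Finsupp.linearCombination _ (Sum.elim
      (fun a => A.d 0 (Finsupp.single a 1)) (fun b => φ 0 (Finsupp.single b 1)))
  | i + 1 => Finsupp.linearCombination _ (Sum.elim
      (fun a => inA A B i (A.d (i + 1) (Finsupp.single a 1)))
      (fun b => inA A B i (φ (i + 1) (Finsupp.single b 1)) - inB A B i (B.d i (Finsupp.single b 1))))

section
variable (A B : GC K σ)
    (φ : ∀ i, (B.ι i →₀ MvPolynomial σ K) →ₗ[MvPolynomial σ K] (A.ι i →₀ MvPolynomial σ K))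

lemma coneD_zero_A (a p) : coneD A B φ 0 (Finsupp.single (jA A B 0 a) p) =
    p • A.d 0 (Finsupp.single a 1) :=
  Finsupp.linearCombination_single _ _ _

lemma coneD_zero_B (a p) : coneD A B φ 0 (Finsupp.single (jB A B 0 a) p) =
    p • φ 0 (Finsupp.single a 1) :=
  Finsupp.linearCombination_single _ _ _

lemma coneD_succ_A (i a p) : coneD A B φ (i + 1) (Finsupp.single (jA A B (i + 1) a) p) =
    p • inA A B i (A.d (i + 1) (Finsupp.single a 1)) :=
  Finsupp.linearCombination_single _ _ _

lemma coneD_succ_B (i a p) : coneD A B φ (i + 1) (Finsupp.single (jB A B (i + 1) a) p) =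
    p • (inA A B i (φ (i + 1) (Finsupp.single a 1)) - inB A B i (B.d i (Finsupp.single a 1))) :=
  Finsupp.linearCombination_single _ _ _

lemma coneD_zero (a b) : coneD A B φ 0 (inA A B 0 a + inB A B 0 b) = A.d 0 a + φ 0 b := by
  rw [map_add]
  congr 1
  · have : coneD A B φ 0 ∘ₗ inA A B 0 = A.d 0 := by
      ext1 c
      ext1
      simp [inA_single, coneD_zero_A]
      rfl
    exact LinearMap.congr_fun this a
  · have : coneD A B φ 0 ∘ₗ inB A B 0 = φ 0 := by
      ext1 c
      ext1
      simp [inB_single, coneD_zero_B]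
      rfl
    exact LinearMap.congr_fun this b

lemma coneD_succ (i a b) : coneD A B φ (i + 1) (inA A B (i + 1) a + inB A B (i + 1) b) =
    inA A B i (A.d (i + 1) a + φ (i + 1) b) + inB A B i (- B.d i b) := by
  have h1 : coneD A B φ (i + 1) (inA A B (i + 1) a) = inA A B i (A.d (i + 1) a) := by
    have : coneD A B φ (i + 1) ∘ₗ inA A B (i + 1) = inA A B i ∘ₗ A.d (i + 1) := by
      ext1 c
      ext1
      simp [inA_single, coneD_succ_A]
    exact LinearMap.congr_fun this a
  have h2 : coneD A B φ (i + 1) (inB A B (i + 1) b) =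
      inA A B i (φ (i + 1) b) - inB A B i (B.d i b) := by
    have : coneD A B φ (i + 1) ∘ₗ inB A B (i + 1) =
        inA A B i ∘ₗ φ (i + 1) - inB A B i ∘ₗ B.d i := by
      ext1 c
      ext1
      simp [inB_single, coneD_succ_B]
    exact LinearMap.congr_fun this b
  rw [map_add, h1, h2, map_add, map_neg]
  abel

end

lemma cone_res (A B : GC K σ)
    (φ : ∀ i, (B.ι i →₀ MvPolynomial σ K) →ₗ[MvPolynomial σ K] (A.ι i →₀ MvPolynomial σ K))
    {J : Ideal (MvPolynomial σ K)} (hA : A.Res J)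
    (m : MvPolynomial σ K) (φ0 : ∀ x, (φ 0 x) A.u = x B.u * m)
    (x : A.ι 0 →₀ MvPolynomial σ K) :
    (∃ y, coneD A B φ 0 y = x) ↔ x A.u ∈ J ⊔ Ideal.span {m} := by
  constructor
  · rintro ⟨y, hy⟩
    obtain ⟨a, b, rfl⟩ := exists_in A B 0 y
    have h0 : A.d 0 a + φ 0 b = x := (coneD_zero A B φ a b).symm.trans hy
    rw [← h0, Finsupp.add_apply, φ0]
    exact Ideal.add_mem _ (Ideal.mem_sup_left ((hA _).1 ⟨a, rfl⟩))
      (Ideal.mem_sup_right (Ideal.mul_mem_left _ _ (Ideal.mem_span_singleton_self m)))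
  · intro hx
    obtain ⟨p, hp, q, hq, hpq⟩ := Submodule.mem_sup.1 hx
    obtain ⟨r, rfl⟩ := Ideal.mem_span_singleton'.1 hq
    obtain ⟨a, ha⟩ := (hA (Finsupp.single A.u p)).2 (by simpa using hp)
    refine ⟨inA A B 0 a + inB A B 0 (Finsupp.single B.u r), (coneD_zero A B φ _ _).trans ?_⟩
    have h1 : φ 0 (Finsupp.single B.u r) = Finsupp.single A.u (r * m) := by
      rw [A.single_u (φ 0 _), φ0, Finsupp.single_eq_same]
    have h2 : Finsupp.single A.u p + Finsupp.single A.u (r * m) = x := by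
      rw [A.single_u x, ← Finsupp.single_add, hpq]
    rw [ha, h1]
    exact h2

/-- The mapping cone lemma. -/
theorem exists_cone (A B : GC K σ) {J J' : Ideal (MvPolynomial σ K)} (hA : A.Res J)
    (hB : B.Res J') (m : MvPolynomial σ K) (s : ℕ) (hm : ∀ α, coeff α m ≠ 0 → α.degree = s)
    (h : ∀ p, p ∈ J' ↔ p * m ∈ J) :
    ∃ E : GC K σ, E.Res (J ⊔ Ideal.span {m}) ∧
      (∀ j, (∃ e, E.deg 0 e = j) ↔ ∃ e, A.deg 0 e = j) ∧
      ∀ i j, (∃ e, E.deg (i + 1) e = j) ↔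
        (∃ e, A.deg (i + 1) e = j) ∨ ∃ e, B.deg i e + s = j := by
  obtain ⟨φ, φ0, φd, φh⟩ := exists_chain B A hB hA m s hm (fun p hp => (h p).1 hp)
  refine ⟨GC.mk (coneι A B) (coneDeg A B s) (coneD A B φ) ?_ ?_ A.u A.uniq A.deg_u,
    ?_, fun j => Iff.rfl, fun i j => ?_⟩
  · intro i
    apply le_antisymm
    · intro x hx
      rw [LinearMap.mem_ker] at hx
      obtain ⟨a, b, rfl⟩ := exists_in A B i x
      have hb : ∃ b', B.d i b' = b ∧ A.d i a + φ i b = 0 := by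
        cases i with
        | zero =>
          rw [coneD_zero] at hx
          have h1 : φ 0 b = A.d 0 (-a) := by rw [map_neg]; exact eq_neg_of_add_eq_zero_right hx
          have h2 : (φ 0 b) A.u ∈ J := (hA _).1 ⟨-a, h1.symm⟩
          rw [φ0, ← h, ← hB] at h2
          obtain ⟨b', hb'⟩ := h2
          exact ⟨b', hb', hx⟩
        | succ i =>
          rw [coneD_succ] at hx
          obtain ⟨h1, h2⟩ := in_inj A B i (a' := 0) (b' := 0)
            (hx.trans (by rw [map_zero, map_zero, add_zero]))
          obtain ⟨b', hb'⟩ := B.exists_of_ker i b (by simpa using h2)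
          exact ⟨b', hb', h1⟩
      obtain ⟨b', rfl, h1⟩ := hb
      rw [← φd, ← map_add] at h1
      obtain ⟨a', ha'⟩ := A.exists_of_ker i _ h1
      refine ⟨inA A B (i + 1) a' + inB A B (i + 1) (-b'), ?_⟩
      rw [coneD_succ, ha', map_neg (φ (i + 1)), map_neg (B.d i), neg_neg]
      congr 2
      abel
    · rintro _ ⟨x, rfl⟩
      obtain ⟨a, b, rfl⟩ := exists_in A B (i + 1) x
      rw [LinearMap.mem_ker, coneD_succ]
      cases i with
      | zero =>
        rw [coneD_zero, map_add, A.dd, map_neg, φd]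
        abel
      | succ i =>
        rw [coneD_succ, map_add (A.d (i + 1)), A.dd, map_neg, φd, map_neg (B.d i), B.dd]
        simp
  · intro i b
    cases i with
    | zero =>
      obtain ⟨b, rfl⟩ | ⟨b, rfl⟩ := j_cases A B _ b
      · have : coneD A B φ 0 (Finsupp.single (jA A B _ b) 1) = A.d 0 (Finsupp.single b 1) := by
          exact (coneD_zero_A A B φ b 1).trans (one_smul _ _)
        rw [this]
        exact A.hom 0 b
      · have : coneD A B φ 0 (Finsupp.single (jB A B _ b) 1) = φ 0 (Finsupp.single b 1) := by
          exact (coneD_zero_B A B φ b 1).trans (one_smul _ _)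
        rw [this]
        exact φh 0 b
    | succ i =>
      obtain ⟨b, rfl⟩ | ⟨b, rfl⟩ := j_cases A B _ b
      · have : coneD A B φ (i + 1) (Finsupp.single (jA A B _ b) 1) =
            inA A B i (A.d (i + 1) (Finsupp.single b 1)) := by
          simp [coneD_succ_A]
        rw [this]
        intro c α hα
        obtain ⟨c, rfl⟩ | ⟨c, rfl⟩ := j_cases A B _ c
        · rw [inA_inl] at hα
          exact A.hom (i + 1) b c α hα
        · rw [inA_inr] at hα
          simp at hα
      · have : coneD A B φ (i + 1) (Finsupp.single (jB A B _ b) 1) =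
            inA A B i (φ (i + 1) (Finsupp.single b 1)) - inB A B i (B.d i (Finsupp.single b 1)) := by
          simp [coneD_succ_B]
        rw [this]
        intro c α hα
        obtain ⟨c, rfl⟩ | ⟨c, rfl⟩ := j_cases A B _ c
        · rw [Finsupp.sub_apply, inA_inl, inB_inl, sub_zero] at hα
          exact φh (i + 1) b c α hα
        · rw [Finsupp.sub_apply, inA_inr, inB_inr, zero_sub, coeff_neg, neg_ne_zero] at hα
          have := B.hom i b c α hα
          change α.degree + (B.deg i c + s) = B.deg (i + 1) b + s + 0
          omega
  · exact cone_res A B φ hA m φ0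
  · constructor
    · rintro ⟨e | e, he⟩
      · exact Or.inl ⟨e, he⟩
      · exact Or.inr ⟨e, he⟩
    · rintro (⟨e, he⟩ | ⟨e, he⟩)
      · exact ⟨Sum.inl e, he⟩
      · exact ⟨Sum.inr e, he⟩

end Cyc

end

noncomputable section

namespace Cyc

variable {K : Type} [Field K] {σ : Type}

/-- The monomial ideal with exponents given by `P` has a graded free resolution of its quotient
whose generators have (homological, internal) degrees exactly given by `T`. -/
def HR (K : Type) [Field K] {σ : Type} (P : (σ →₀ ℕ) → Prop) (T : ℕ → ℕ → Prop) : Prop :=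
  ∃ J : Ideal (MvPolynomial σ K), (∀ p, p ∈ J ↔ ∀ α, coeff α p ≠ 0 → P α) ∧
    ∃ E : GC K σ, E.Res J ∧ ∀ i j, (∃ e, E.deg i e = j) ↔ T i j

/-- degree set of the cone -/
def coneT (A B : ℕ → ℕ → Prop) (s : ℕ) (i j : ℕ) : Prop :=
  A i j ∨ ∃ i' j', i = i' + 1 ∧ j = j' + s ∧ B i' j'

theorem HR_cone {P : (σ →₀ ℕ) → Prop} {A B : ℕ → ℕ → Prop} (m : σ →₀ ℕ) (hA : HR K P A)
    (hB : HR K (fun α => P (α + m)) B) :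
    HR K (fun α => P α ∨ m ≤ α) (coneT A B m.degree) := by
  classical
  obtain ⟨J, hJ, X, hX, hXT⟩ := hA
  obtain ⟨J', hJ', Y, hY, hYT⟩ := hB
  obtain ⟨E, hE, h0, h1⟩ := exists_cone X Y hX hY (monomial m 1) m.degree
    (by
      intro α hα
      rw [coeff_monomial] at hα
      split_ifs at hα with h
      · rw [h]
      · simp at hα)
    (by
      intro p
      rw [hJ, hJ']
      constructor
      · intro h β hβ
        rw [coeff_mul_monomial'] at hβ
        split_ifs at hβ with hm
        · have : P (β - m + m) := h (β - m) (by simpa using hβ)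
          rwa [tsub_add_cancel_of_le hm] at this
        · simp at hβ
      · intro h α hα
        apply h
        rw [coeff_mul_monomial]
        simpa using hα)
  refine ⟨_, ?_, E, hE, ?_⟩
  · intro p
    constructor
    · intro hp α hα
      obtain ⟨a, ha, q, hq, rfl⟩ := Submodule.mem_sup.1 hp
      obtain ⟨r, rfl⟩ := Ideal.mem_span_singleton'.1 hq
      by_cases h : coeff α a = 0
      · right
        by_contra hm
        rw [coeff_add, h, coeff_mul_monomial', if_neg hm] at hα
        simp at hα
      · exact Or.inl ((hJ a).1 ha α h)
    · intro h
      rw [← support_sum_monomial_coeff p]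
      refine Ideal.sum_mem _ fun α hα => ?_
      rcases h α (mem_support_iff.1 hα) with h | h
      · apply Ideal.mem_sup_left
        rw [hJ]
        intro β hβ
        rw [coeff_monomial] at hβ
        split_ifs at hβ with h'
        · rwa [← h']
        · simp at hβ
      · apply Ideal.mem_sup_right
        rw [Ideal.mem_span_singleton']
        refine ⟨monomial (α - m) (coeff α p), ?_⟩
        rw [monomial_mul, tsub_add_cancel_of_le h, mul_one]
  · intro i j
    unfold coneT
    cases i with
    | zero =>
      rw [h0, hXT]
      simp
    | succ i =>
      rw [h1, hXT]
      apply or_congr Iff.rfl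
      constructor
      · rintro ⟨e, rfl⟩
        exact ⟨i, _, rfl, rfl, (hYT _ _).1 ⟨e, rfl⟩⟩
      · rintro ⟨i', j', h, rfl, hB⟩
        obtain rfl : i = i' := by omega
        obtain ⟨e, rfl⟩ := (hYT _ _).2 hB
        exact ⟨e, rfl⟩

/-- trivial complex -/
def trivι : ℕ → Type
  | 0 => Unit
  | _ + 1 => Empty

instance (i : ℕ) : IsEmpty (trivι (i + 1)) := inferInstanceAs (IsEmpty Empty)

theorem HR_bot : HR K (fun _ : σ →₀ ℕ => False) (fun i j => i = 0 ∧ j = 0) := by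
  refine ⟨⊥, ?_, GC.mk trivι (fun _ _ => 0) (fun _ => 0) ?_ ?_ () (fun _ => rfl) rfl, ?_, ?_⟩
  · intro p
    rw [Ideal.mem_bot]
    constructor
    · rintro rfl
      simp
    · intro h
      ext α
      by_contra h'
      exact h α h'
  · intro i
    ext x
    rw [Subsingleton.elim x 0]
    simp
  · intro i b
    exact isEmptyElim b
  · intro x
    change x ∈ LinearMap.range (0 : (trivι 1 →₀ MvPolynomial σ K) →ₗ[MvPolynomial σ K] _) ↔ _
    rw [LinearMap.range_zero, Submodule.mem_bot, Ideal.mem_bot]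
    constructor
    · rintro rfl; rfl
    · intro h
      ext1 c
      exact h
  · intro i j
    constructor
    · rintro ⟨e, rfl⟩
      cases i with
      | zero => exact ⟨rfl, rfl⟩
      | succ i => exact isEmptyElim e
    · rintro ⟨rfl, rfl⟩
      exact ⟨(), rfl⟩

lemma HR_congr {P Q : (σ →₀ ℕ) → Prop} {T U : ℕ → ℕ → Prop} (h : HR K P T)
    (hP : ∀ α, P α ↔ Q α) (hT : ∀ i j, T i j ↔ U i j) : HR K Q U := by
  obtain rfl : P = Q := funext fun α => propext (hP α)
  obtain rfl : T = U := funext fun i => funext fun j => propext (hT i j)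
  exact h

/-- support of an exponent, as a predicate on `ℕ` -/
def nz {n : ℕ} (α : Fin n →₀ ℕ) (a : ℕ) : Prop := ∃ h : a < n, α ⟨a, h⟩ ≠ 0

lemma nz_add_single {n : ℕ} (α : Fin n →₀ ℕ) (u : ℕ) (hu : u < n) (a : ℕ) :
    nz (α + Finsupp.single ⟨u, hu⟩ 1) a ↔ nz α a ∨ a = u := by
  classical
  unfold nz
  constructor
  · rintro ⟨h, h'⟩
    by_cases hau : a = u
    · exact Or.inr hau
    · left
      refine ⟨h, ?_⟩
      rw [Finsupp.add_apply, Finsupp.single_apply, if_neg (by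
        intro h2; apply hau; exact (Fin.mk.inj h2).symm)] at h'
      simpa using h'
  · rintro (⟨h, h'⟩ | rfl)
    · refine ⟨h, ?_⟩
      rw [Finsupp.add_apply]
      omega
    · refine ⟨hu, ?_⟩
      simp

lemma single_le_iff {n : ℕ} (α : Fin n →₀ ℕ) (u : ℕ) (hu : u < n) :
    Finsupp.single ⟨u, hu⟩ 1 ≤ α ↔ nz α u := by
  unfold nz
  rw [Finsupp.single_le_iff]
  constructor
  · intro h; exact ⟨hu, by omega⟩
  · rintro ⟨_, h⟩; omega

lemma pair_le_iff {n : ℕ} (α : Fin n →₀ ℕ) (u v : ℕ) (hu : u < n) (hv : v < n) (huv : u ≠ v) :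
    Finsupp.single ⟨u, hu⟩ 1 + Finsupp.single ⟨v, hv⟩ 1 ≤ α ↔ nz α u ∧ nz α v := by
  classical
  constructor
  · intro h
    exact ⟨(single_le_iff α u hu).1 (le_trans (le_add_of_nonneg_right (by simp)) h),
      (single_le_iff α v hv).1 (le_trans (le_add_of_nonneg_left (by simp)) h)⟩
  · rintro ⟨⟨_, h1⟩, ⟨_, h2⟩⟩ c
    rw [Finsupp.add_apply, Finsupp.single_apply, Finsupp.single_apply]
    split_ifs with h3 h4 h4
    · exact absurd (Fin.mk.inj (h3.trans h4.symm)) huv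
    · subst h3; omega
    · subst h4; omega
    · omega

theorem HR_edge {n : ℕ} {P P' Q : (ℕ → Prop) → Prop} {A B : ℕ → ℕ → Prop} (u v : ℕ)
    (hu : u < n) (hv : v < n) (huv : u ≠ v)
    (hA : HR K (fun α : Fin n →₀ ℕ => P (nz α)) A) (hB : HR K (fun α : Fin n →₀ ℕ => P' (nz α)) B)
    (hP' : ∀ z, P (fun a => z a ∨ a = u ∨ a = v) ↔ P' z)
    (hQ : ∀ z, P z ∨ (z u ∧ z v) ↔ Q z) :
    HR K (fun α : Fin n →₀ ℕ => Q (nz α)) (coneT A B 2) := by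
  have h := HR_cone (Finsupp.single ⟨u, hu⟩ 1 + Finsupp.single ⟨v, hv⟩ 1) hA
    (HR_congr hB (fun α => by
      rw [← hP']
      have : (fun a => nz α a ∨ a = u ∨ a = v) =
          nz (α + (Finsupp.single ⟨u, hu⟩ 1 + Finsupp.single ⟨v, hv⟩ 1)) := by
        funext a
        rw [← add_assoc, nz_add_single, nz_add_single, or_assoc]
      rw [this]) (fun i j => Iff.rfl))
  refine HR_congr h (fun α => ?_) (fun i j => ?_)
  · rw [pair_le_iff _ _ _ _ _ huv, hQ]
  · simp

theorem HR_var {n : ℕ} {P Q : (ℕ → Prop) → Prop} {A : ℕ → ℕ → Prop} (u : ℕ) (hu : u < n)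
    (hA : HR K (fun α : Fin n →₀ ℕ => P (nz α)) A)
    (hP' : ∀ z, P (fun a => z a ∨ a = u) ↔ P z)
    (hQ : ∀ z, P z ∨ z u ↔ Q z) :
    HR K (fun α : Fin n →₀ ℕ => Q (nz α)) (coneT A A 1) := by
  have h := HR_cone (Finsupp.single ⟨u, hu⟩ 1) hA
    (HR_congr hA (fun α => by
      rw [← hP']
      have : (fun a => nz α a ∨ a = u) = nz (α + (Finsupp.single ⟨u, hu⟩ 1)) := by
        funext a
        rw [nz_add_single]
      rw [this]) (fun i j => Iff.rfl))
  refine HR_congr h (fun α => ?_) (fun i j => ?_)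
  · rw [single_le_iff, hQ]
  · simp

theorem HR_vars {n : ℕ} (V : Finset ℕ) (hV : ∀ j ∈ V, j < n) :
    HR K (fun α : Fin n →₀ ℕ => ∃ j ∈ V, nz α j) (fun i j => j = i ∧ i ≤ V.card) := by
  classical
  induction V using Finset.induction_on with
  | empty =>
    refine HR_congr HR_bot (fun α => by simp) (fun i j => ?_)
    simp; omega
  | insert u V hu ih =>
    have := HR_var (P := fun z => ∃ j ∈ V, z j) (Q := fun z => ∃ j ∈ insert u V, z j) u
      (hV u (Finset.mem_insert_self _ _))
      (ih (fun j hj => hV j (Finset.mem_insert_of_mem hj)))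
      (by
        intro z
        constructor
        · rintro ⟨j, hj, h | rfl⟩
          · exact ⟨j, hj, h⟩
          · exact absurd hj hu
        · rintro ⟨j, hj, h⟩
          exact ⟨j, hj, Or.inl h⟩)
      (by
        intro z
        rw [Finset.exists_mem_insert, or_comm])
    refine HR_congr this (fun α => Iff.rfl) (fun i j => ?_)
    rw [Finset.card_insert_of_notMem hu]
    unfold coneT
    constructor
    · rintro (h | ⟨i', j', rfl, rfl, h⟩) <;> omega
    · rintro ⟨rfl, h⟩
      by_cases h' : j ≤ V.card
      · exact Or.inl ⟨rfl, h'⟩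
      · exact Or.inr ⟨j - 1, j - 1, by omega, by omega, rfl, by omega⟩

theorem HR_varsq {n : ℕ} (V : Finset ℕ) (hV : ∀ j ∈ V, j < n) (u v : ℕ) (hu : u < n) (hv : v < n)
    (huv : u ≠ v) (huV : u ∉ V) (hvV : v ∉ V) :
    HR K (fun α : Fin n →₀ ℕ => (∃ j ∈ V, nz α j) ∨ (nz α u ∧ nz α v))
      (fun i j => (j = i ∧ i ≤ V.card) ∨ (j = i + 1 ∧ 1 ≤ i ∧ i ≤ V.card + 1)) := by
  have := HR_edge (K := K) (P := fun z => ∃ j ∈ V, z j) (P' := fun z => ∃ j ∈ V, z j)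
    (Q := fun z => (∃ j ∈ V, z j) ∨ (z u ∧ z v)) u v hu hv huv (HR_vars V hV) (HR_vars V hV)
    (by
      intro z
      constructor
      · rintro ⟨j, hj, h | rfl | rfl⟩
        · exact ⟨j, hj, h⟩
        · exact absurd hj huV
        · exact absurd hj hvV
      · rintro ⟨j, hj, h⟩
        exact ⟨j, hj, Or.inl h⟩) (fun z => Iff.rfl)
  refine HR_congr this (fun α => Iff.rfl) (fun i j => ?_)
  unfold coneT
  apply or_congr Iff.rfl
  constructor
  · rintro ⟨i', j', rfl, rfl, h⟩; omega
  · rintro ⟨rfl, h, h'⟩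
    exact ⟨i - 1, i - 1, by omega, by omega, rfl, by omega⟩

/-- partial path ideals -/
def Q (k l : ℕ) (z : ℕ → Prop) : Prop :=
  ∃ a b, a + 2 ≤ b ∧ z a ∧ z b ∧ (b < k ∨ (b = k ∧ a < l))

/-- partial cycle ideals -/
def QC (n l : ℕ) (z : ℕ → Prop) : Prop :=
  Q (n - 1) 0 z ∨ ∃ a, 1 ≤ a ∧ a < l ∧ a + 2 ≤ n - 1 ∧ z a ∧ z (n - 1)

/-- linear resolution of bounded length -/
def Lin (K : Type) [Field K] {n : ℕ} (k : ℕ) (P : (Fin n →₀ ℕ) → Prop) : Prop :=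
  ∃ T, HR K P T ∧ ∀ i j, T i j → (i = 0 ∧ j = 0) ∨ (j = i + 1 ∧ i ≤ k)

lemma card_V (k l : ℕ) (h : l + 2 ≤ k) : (((Finset.range k).erase l).erase (l + 1)).card = k - 2 := by
  rw [Finset.card_erase_of_mem (by simp; omega), Finset.card_erase_of_mem (by simp; omega),
    Finset.card_range]
  omega

lemma mem_V (k l j : ℕ) :
    j ∈ ((Finset.range k).erase l).erase (l + 1) ↔ j < k ∧ j ≠ l ∧ j ≠ l + 1 := by
  simp; tauto

lemma lin_step {n k l : ℕ} (hk : k + 2 ≤ n) (hl : l + 2 ≤ k)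
    (h : Lin K (n - 2) (fun α : Fin n →₀ ℕ => Q k l (nz α))) :
    Lin K (n - 2) (fun α : Fin n →₀ ℕ => Q k (l + 1) (nz α)) := by
  obtain ⟨T, hT, hT'⟩ := h
  refine ⟨_, HR_edge (P := Q k l)
    (P' := fun z => ∃ j ∈ ((Finset.range k).erase l).erase (l + 1), z j) (Q := Q k (l + 1)) l k (by omega) (by omega) (by omega) hT
    (HR_vars (((Finset.range k).erase l).erase (l + 1)) (fun j hj => by
      rw [mem_V] at hj; omega)) ?_ ?_, ?_⟩
  · intro z
    simp only [mem_V]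
    constructor
    · rintro ⟨a, b, hab, ha, hb, hc⟩
      by_cases hbk : b = k
      · exact ⟨a, by omega, by rcases ha with ha | ha | ha <;> first | exact ha | omega⟩
      · by_cases hbl : b = l ∨ b = l + 1
        · exact ⟨a, by omega, by rcases ha with ha | ha | ha <;> first | exact ha | omega⟩
        · exact ⟨b, by omega, by rcases hb with hb | hb | hb <;> first | exact hb | omega⟩
    · rintro ⟨j, hj, hz⟩
      by_cases hjl : j < l
      · exact ⟨j, k, by omega, Or.inl hz, by simp, by omega⟩
      · exact ⟨l, j, by omega, by simp, Or.inl hz, by omega⟩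
  · intro z
    constructor
    · rintro (⟨a, b, hab, ha, hb, hc⟩ | ⟨h1, h2⟩)
      · exact ⟨a, b, hab, ha, hb, by omega⟩
      · exact ⟨l, k, hl, h1, h2, by omega⟩
    · rintro ⟨a, b, hab, ha, hb, hc⟩
      by_cases h' : b = k ∧ a = l
      · obtain ⟨rfl, rfl⟩ := h'
        exact Or.inr ⟨ha, hb⟩
      · exact Or.inl ⟨a, b, hab, ha, hb, by omega⟩
  · rintro i j (h | ⟨i', j', rfl, rfl, h⟩)
    · exact hT' i j h
    · rw [card_V k l hl] at h
      omega

lemma lin_path {n : ℕ} (k : ℕ) (hk : k + 1 ≤ n) :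
    Lin K (n - 2) (fun α : Fin n →₀ ℕ => Q k 0 (nz α)) := by
  induction k with
  | zero =>
    refine ⟨_, HR_congr HR_bot (fun α => ?_) (fun i j => Iff.rfl), fun i j h => Or.inl h⟩
    constructor
    · exact False.elim
    · rintro ⟨a, b, h1, h2, h3, h4⟩
      omega
  | succ k ih =>
    have key : ∀ l, l ≤ k - 1 → Lin K (n - 2) (fun α : Fin n →₀ ℕ => Q k l (nz α)) := by
      intro l
      induction l with
      | zero => intro _; exact ih (by omega)
      | succ l ihl => intro hl; exact lin_step (by omega) (by omega) (ihl (by omega))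
    obtain ⟨T, hT, hT'⟩ := key (k - 1) le_rfl
    refine ⟨T, HR_congr hT (fun α => ?_) (fun i j => Iff.rfl), hT'⟩
    constructor
    · rintro ⟨a, b, hab, ha, hb, hc⟩
      exact ⟨a, b, hab, ha, hb, by omega⟩
    · rintro ⟨a, b, hab, ha, hb, hc⟩
      exact ⟨a, b, hab, ha, hb, by omega⟩

/-- degree bounds for the cycle ideals -/
def CycT (K : Type) [Field K] (n : ℕ) (P : (Fin n →₀ ℕ) → Prop) : Prop :=
  ∃ T, HR K P T ∧ (∀ i j, T i j → (i = 0 ∧ j = 0) ∨ (i ≤ n - 2 ∧ (j = i + 1 ∨ j = i + 2))) ∧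
    T (n - 2) n

lemma cyc_two {n : ℕ} (hn : 3 < n) : CycT K n (fun α : Fin n →₀ ℕ => QC n 2 (nz α)) := by
  obtain ⟨T, hT, hT'⟩ := lin_path (K := K) (n := n) (n - 1) (by omega)
  refine ⟨_, HR_edge (P := Q (n - 1) 0)
    (P' := fun z => (∃ j ∈ Finset.Ico 3 (n - 1), z j) ∨ (z 0 ∧ z 2)) (Q := QC n 2) 1 (n - 1)
    (by omega) (by omega) (by omega) hT
    (HR_varsq (Finset.Ico 3 (n - 1)) (fun j hj => by
      rw [Finset.mem_Ico] at hj; omega) 0 2 (by omega) (by omega) (by omega) (by simp) (by simp))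
      ?_ ?_, ?_, ?_⟩
  · intro z
    simp only [Finset.mem_Ico]
    constructor
    · rintro ⟨a, b, hab, ha, hb, hc⟩
      have hb' : z b := by rcases hb with hb | hb | hb <;> first | exact hb | omega
      by_cases hb3 : 3 ≤ b
      · exact Or.inl ⟨b, by omega, hb'⟩
      · obtain rfl : b = 2 := by omega
        obtain rfl : a = 0 := by omega
        refine Or.inr ⟨?_, hb'⟩
        rcases ha with ha | ha | ha <;> first | exact ha | omega
    · rintro (⟨j, hj, hz⟩ | ⟨h1, h2⟩)
      · exact ⟨1, j, by omega, by simp, Or.inl hz, by omega⟩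
      · exact ⟨0, 2, by omega, Or.inl h1, Or.inl h2, by omega⟩
  · intro z
    apply or_congr Iff.rfl
    constructor
    · rintro ⟨h1, h2⟩
      exact ⟨1, by omega, by omega, by omega, h1, h2⟩
    · rintro ⟨a, h1, h2, h3, h4, h5⟩
      obtain rfl : a = 1 := by omega
      exact ⟨h4, h5⟩
  · rintro i j (h | ⟨i', j', rfl, rfl, h⟩)
    · have := hT' i j h
      omega
    · rw [Nat.card_Ico] at h
      omega
  · refine Or.inr ⟨n - 3, n - 2, by omega, by omega, ?_⟩
    rw [Nat.card_Ico]
    omega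

lemma cyc_step {n l : ℕ} (hl : 2 ≤ l) (hln : l + 3 ≤ n)
    (h : CycT K n (fun α : Fin n →₀ ℕ => QC n l (nz α))) :
    CycT K n (fun α : Fin n →₀ ℕ => QC n (l + 1) (nz α)) := by
  obtain ⟨T, hT, hT', hT2⟩ := h
  refine ⟨_, HR_edge (P := QC n l)
    (P' := fun z => ∃ j ∈ ((Finset.range (n - 1)).erase l).erase (l + 1), z j)
    (Q := QC n (l + 1)) l (n - 1) (by omega) (by omega) (by omega) hT
    (HR_vars (((Finset.range (n - 1)).erase l).erase (l + 1)) (fun j hj => by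
      rw [mem_V] at hj; omega)) ?_ ?_, ?_, Or.inl hT2⟩
  · intro z
    simp only [mem_V]
    constructor
    · rintro (⟨a, b, hab, ha, hb, hc⟩ | ⟨a, h1, h2, h3, ha, hb⟩)
      · by_cases hbl : b = l ∨ b = l + 1
        · exact ⟨a, by omega, by rcases ha with ha | ha | ha <;> first | exact ha | omega⟩
        · exact ⟨b, by omega, by rcases hb with hb | hb | hb <;> first | exact hb | omega⟩
      · exact ⟨a, by omega, by rcases ha with ha | ha | ha <;> first | exact ha | omega⟩
    · rintro ⟨j, hj, hz⟩
      by_cases hj0 : j = 0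
      · subst hj0
        exact Or.inl ⟨0, l, by omega, Or.inl hz, by simp, by omega⟩
      by_cases hjl : j < l
      · exact Or.inr ⟨j, by omega, by omega, by omega, Or.inl hz, by simp⟩
      · exact Or.inl ⟨l, j, by omega, by simp, Or.inl hz, by omega⟩
  · intro z
    constructor
    · rintro ((h | ⟨a, h1, h2, h3, ha, hb⟩) | ⟨h1, h2⟩)
      · exact Or.inl h
      · exact Or.inr ⟨a, h1, by omega, h3, ha, hb⟩
      · exact Or.inr ⟨l, by omega, by omega, by omega, h1, h2⟩
    · rintro (h | ⟨a, h1, h2, h3, ha, hb⟩)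
      · exact Or.inl (Or.inl h)
      · by_cases h' : a = l
        · subst h'
          exact Or.inr ⟨ha, hb⟩
        · exact Or.inl (Or.inr ⟨a, h1, by omega, h3, ha, hb⟩)
  · rintro i j (h | ⟨i', j', rfl, rfl, h⟩)
    · exact hT' i j h
    · rw [card_V (n - 1) l (by omega)] at h
      omega

lemma cyc_all {n : ℕ} (hn : 3 < n) : CycT K n (fun α : Fin n →₀ ℕ => QC n (n - 2) (nz α)) := by
  have key : ∀ l, l + 4 ≤ n → CycT K n (fun α : Fin n →₀ ℕ => QC n (l + 2) (nz α)) := by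
    intro l
    induction l with
    | zero => intro _; exact cyc_two hn
    | succ l ih =>
      intro h
      exact cyc_step (l := l + 2) (by omega) (by omega) (ih (by omega))
  have := key (n - 4) (by omega)
  rwa [show n - 4 + 2 = n - 2 by omega] at this

lemma adj_iff {n : ℕ} (hn : 3 < n) (i j : Fin n) (hij : i.val < j.val) :
    (SimpleGraph.cycleGraph n)ᶜ.Adj i j ↔
      i.val + 2 ≤ j.val ∧ ¬ (i.val = 0 ∧ j.val = n - 1) := by
  have hne : i ≠ j := fun h => by rw [h] at hij; exact lt_irrefl _ hij
  rw [SimpleGraph.compl_adj, SimpleGraph.cycleGraph_adj']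
  have h1 : (j - i).val = j.val - i.val := Fin.sub_val_of_le (by rw [Fin.le_def]; omega)
  have h2 : (i - j).val = n - j.val + i.val := by
    rw [Fin.sub_def]
    exact Nat.mod_eq_of_lt (by have := j.2; omega)
  rw [h1, h2]
  have := j.2
  simp only [hne, ne_eq, not_false_eq_true, true_and]
  omega

lemma QC_iff {n : ℕ} (hn : 3 < n) (α : Fin n →₀ ℕ) : QC n (n - 2) (nz α) ↔
    ∃ i j, (SimpleGraph.cycleGraph n)ᶜ.Adj i j ∧ α i ≠ 0 ∧ α j ≠ 0 := by
  constructor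
  · rintro (⟨a, b, hab, ⟨ha, ha'⟩, ⟨hb, hb'⟩, hc⟩ | ⟨a, h1, h2, h3, ⟨ha, ha'⟩, ⟨hb, hb'⟩⟩)
    · exact ⟨⟨a, ha⟩, ⟨b, hb⟩, (adj_iff hn _ _ (by simp; omega)).2 (by simp; omega), ha', hb'⟩
    · exact ⟨⟨a, ha⟩, ⟨n - 1, hb⟩, (adj_iff hn _ _ (by simp; omega)).2 (by simp; omega), ha', hb'⟩
  · have key : ∀ i j : Fin n, i.val < j.val → (SimpleGraph.cycleGraph n)ᶜ.Adj i j → α i ≠ 0 →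
        α j ≠ 0 → QC n (n - 2) (nz α) := by
      intro i j hij hadj hi hj
      rw [adj_iff hn i j hij] at hadj
      have := j.2
      by_cases hjn : j.val = n - 1
      · exact Or.inr ⟨i, by omega, by omega, by omega, ⟨i.2, hi⟩, hjn ▸ ⟨j.2, hj⟩⟩
      · exact Or.inl ⟨i, j, by omega, ⟨i.2, hi⟩, ⟨j.2, hj⟩, by omega⟩
    rintro ⟨i, j, hadj, hi, hj⟩
    rcases lt_trichotomy i.val j.val with h | h | h
    · exact key i j h hadj hi hj
    · exact absurd (Fin.ext h) hadj.ne
    · exact key j i h hadj.symm hj hi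

lemma mem_edgeIdeal_iff {τ : Type} (G : SimpleGraph τ) (p : MvPolynomial τ K) :
    p ∈ edgeIdeal K G ↔ ∀ α, coeff α p ≠ 0 → ∃ i j, G.Adj i j ∧ α i ≠ 0 ∧ α j ≠ 0 := by
  classical
  constructor
  · intro hp α hα
    induction hp using Submodule.span_induction generalizing α with
    | mem x hx =>
      obtain ⟨i, j, hij, rfl⟩ := hx
      refine ⟨i, j, hij, ?_⟩
      rw [X, X, monomial_mul, coeff_monomial] at hα
      split_ifs at hα with h
      · rw [← h]
        simp
      · simp at hα
    | zero => simp at hα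
    | add x y _ _ hx hy =>
      by_cases h : coeff α x = 0
      · exact hy α (by rw [coeff_add, h, zero_add] at hα; exact hα)
      · exact hx α h
    | smul r x _ hx =>
      rw [smul_eq_mul, coeff_mul] at hα
      obtain ⟨⟨β, γ⟩, hm, hne⟩ := Finset.exists_ne_zero_of_sum_ne_zero hα
      rw [Finset.HasAntidiagonal.mem_antidiagonal] at hm
      obtain ⟨i, j, hij, h1, h2⟩ := hx γ (right_ne_zero_of_mul hne)
      refine ⟨i, j, hij, ?_, ?_⟩ <;> · rw [← hm]; simp only [Finsupp.add_apply]; omega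
  · intro h
    rw [← support_sum_monomial_coeff p]
    refine Ideal.sum_mem _ fun α hα => ?_
    obtain ⟨i, j, hij, h1, h2⟩ := h α (mem_support_iff.1 hα)
    have hle : Finsupp.single i 1 + Finsupp.single j 1 ≤ α := by
      intro c
      rw [Finsupp.add_apply, Finsupp.single_apply, Finsupp.single_apply]
      split_ifs with h3 h4 h4
      · exact absurd (h3.trans h4.symm) hij.ne
      · subst h3; omega
      · subst h4; omega
      · omega
    have : monomial α (coeff α p) =
        monomial (α - (Finsupp.single i 1 + Finsupp.single j 1)) (coeff α p) * (X i * X j) := by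
      rw [X, X, monomial_mul, monomial_mul, tsub_add_cancel_of_le hle]
      simp
    rw [this]
    exact Ideal.mul_mem_left _ _ (Ideal.subset_span ⟨i, j, hij, rfl⟩)

theorem exists_E {n : ℕ} (hn : 3 < n) :
    ∃ E : GC K (Fin n), E.Res (edgeIdeal K (SimpleGraph.cycleGraph n)ᶜ) ∧
      (∀ i e, (i = 0 ∧ E.deg i e = 0) ∨
        (i ≤ n - 2 ∧ (E.deg i e = i + 1 ∨ E.deg i e = i + 2))) ∧
      ∃ e, E.deg (n - 2) e = n := by
  obtain ⟨T, ⟨J, hJ, E, hE, hET⟩, hT, hT2⟩ := cyc_all (K := K) hn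
  have : J = edgeIdeal K (SimpleGraph.cycleGraph n)ᶜ := by
    ext p
    rw [hJ, mem_edgeIdeal_iff]
    simp only [QC_iff hn]
  subst this
  exact ⟨E, hE, fun i e => hT _ _ ((hET _ _).1 ⟨e, rfl⟩), (hET _ _).2 hT2⟩

end Cyc

end

noncomputable section

namespace Cyc

variable {K : Type} [Field K] {σ : Type}

/-- a submodule generated by homogeneous elements -/
def CompC {ι : Type} (deg : ι → ℕ) (N : Submodule (MvPolynomial σ K) (ι →₀ MvPolynomial σ K)) :
    Prop :=
  ∀ x ∈ N, ∀ e, comp deg e x ∈ N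

lemma eq_sum_comp {ι : Type} (deg : ι → ℕ) (x : ι →₀ MvPolynomial σ K) :
    ∃ B, x = ∑ e ∈ Finset.range B, comp deg e x := by
  classical
  let B := (x.support.sup fun c => (x c).support.sup fun α => α.degree + deg c) + 1
  refine ⟨B, ?_⟩
  ext c α
  rw [Finsupp.finsetSum_apply, coeff_sum]
  simp only [comp_apply, coeff_pj]
  rw [Finset.sum_ite_eq]
  split_ifs with h
  · rfl
  · by_contra h'
    apply h
    have h1 : c ∈ x.support := by
      rw [Finsupp.mem_support_iff]
      intro h0
      rw [h0] at h'
      simp at h'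
    have h2 : α ∈ (x c).support := mem_support_iff.2 h'
    have h3 : α.degree + deg c ≤ (x c).support.sup fun α => α.degree + deg c :=
      Finset.le_sup (f := fun α : σ →₀ ℕ => α.degree + deg c) h2
    have h4 := Finset.le_sup (f := fun c => (x c).support.sup fun α => α.degree + deg c) h1
    rw [Finset.mem_range]
    exact Nat.lt_succ_of_le (h3.trans h4)

lemma exists_hom_gens [Finite σ] {ι : Type} [Finite ι] (deg : ι → ℕ)
    (N : Submodule (MvPolynomial σ K) (ι →₀ MvPolynomial σ K)) (hN : CompC deg N) :
    ∃ G : Finset (ι →₀ MvPolynomial σ K), (∀ g ∈ G, ∃ e, HomE deg e g) ∧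
      Submodule.span (MvPolynomial σ K) (G : Set (ι →₀ MvPolynomial σ K)) = N := by
  have hs : Submodule.span (MvPolynomial σ K) {x | x ∈ N ∧ ∃ e, HomE deg e x} = N := by
    apply le_antisymm
    · rw [Submodule.span_le]
      intro x hx
      exact hx.1
    · intro x hx
      obtain ⟨B, hB⟩ := eq_sum_comp deg x
      rw [hB]
      exact Submodule.sum_mem _ fun e _ =>
        Submodule.subset_span ⟨hN x hx e, e, comp_homE _ _ _⟩
  have hfg : N.FG := IsNoetherian.noetherian N
  rw [← hs, Submodule.fg_span_iff_fg_span_finset_subset] at hfg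
  obtain ⟨G, hG, h⟩ := hfg
  exact ⟨G, fun g hg => (hG hg).2, by rw [← h, hs]⟩

theorem res_step [Finite σ] {ι : Type} [Finite ι] (deg : ι → ℕ)
    (N : Submodule (MvPolynomial σ K) (ι →₀ MvPolynomial σ K)) (hN : CompC deg N) :
    ∃ (ι' : Type) (_ : Finite ι') (deg' : ι' → ℕ)
      (D : (ι' →₀ MvPolynomial σ K) →ₗ[MvPolynomial σ K] (ι →₀ MvPolynomial σ K)),
      LinearMap.range D = N ∧ HomM deg' deg 0 D ∧
        ∀ x, D x = 0 → ∀ b, constantCoeff (x b) = 0 := by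
  classical
  have hex : ∃ k, ∃ G : Finset (ι →₀ MvPolynomial σ K), G.card = k ∧
      (∀ g ∈ G, ∃ e, HomE deg e g) ∧
      Submodule.span (MvPolynomial σ K) (G : Set (ι →₀ MvPolynomial σ K)) = N := by
    obtain ⟨G, h⟩ := exists_hom_gens deg N hN
    exact ⟨_, G, rfl, h⟩
  obtain ⟨G, hGc, hGh, hGs⟩ := Nat.find_spec hex
  choose! dg hdg using hGh
  let D : ({g // g ∈ G} →₀ MvPolynomial σ K) →ₗ[MvPolynomial σ K]
      (ι →₀ MvPolynomial σ K) := Finsupp.linearCombination (MvPolynomial σ K) Subtype.val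
  have hD1 : ∀ (b : {g // g ∈ G}) p, D (Finsupp.single b p) = p • b.1 := by
    intro b p
    exact Finsupp.linearCombination_single _ _ _
  have hDh : HomM (fun b : {g // g ∈ G} => dg b.1) deg 0 D := by
    intro b
    rw [hD1, one_smul]
    exact hdg _ b.2
  refine ⟨{g // g ∈ G}, inferInstance, fun b => dg b.1, D, ?_, hDh, ?_⟩
  · rw [← hGs]
    have := Finsupp.range_linearCombination (MvPolynomial σ K)
      (v := (Subtype.val : {g // g ∈ G} → (ι →₀ MvPolynomial σ K)))
    rw [Subtype.range_val_subtype] at this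
    exact this
  · intro x hx b
    by_contra hne
    set y := comp (fun b : {g // g ∈ G} => dg b.1) (dg b.1) x with hy
    have hDy : D y = 0 := by
      rw [hy, ← comp_map hDh, hx, comp_zero]
    have hyb : y b = C (constantCoeff (x b)) := by
      ext α
      rw [hy, comp_apply, coeff_pj, coeff_C]
      by_cases hα : α = 0
      · subst hα
        simp [constantCoeff_eq]
      · rw [if_neg, if_neg (Ne.symm hα)]
        intro h
        apply hα
        rw [← Finsupp.degree_eq_zero_iff]
        omega
    have hsplit : y b • b.1 + D (y.erase b) = 0 := by
      rw [← hD1, ← map_add, Finsupp.single_add_erase, hDy]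
    have hmem : D (y.erase b) ∈ Submodule.span (MvPolynomial σ K)
        ((G.erase b.1 : Finset _) : Set (ι →₀ MvPolynomial σ K)) := by
      change Finsupp.linearCombination (MvPolynomial σ K) Subtype.val _ ∈ _
      rw [Finsupp.linearCombination_apply]
      refine Submodule.sum_mem _ fun c hc => ?_
      apply Submodule.smul_mem
      apply Submodule.subset_span
      rw [Finsupp.support_erase, Finset.mem_erase] at hc
      rw [Finset.mem_coe, Finset.mem_erase]
      exact ⟨fun h => hc.1 (Subtype.ext h), c.2⟩
    have hb : b.1 ∈ Submodule.span (MvPolynomial σ K)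
        ((G.erase b.1 : Finset _) : Set (ι →₀ MvPolynomial σ K)) := by
      have h1 : y b • b.1 ∈ Submodule.span (MvPolynomial σ K)
          ((G.erase b.1 : Finset _) : Set (ι →₀ MvPolynomial σ K)) := by
        rw [eq_neg_of_add_eq_zero_left hsplit]
        exact Submodule.neg_mem _ hmem
      have h2 := Submodule.smul_mem _ (C (constantCoeff (x b))⁻¹) h1
      rw [hyb, smul_smul, ← C_mul, inv_mul_cancel₀ hne, C_1, one_smul] at h2
      exact h2
    have hlt : (G.erase b.1).card < Nat.find hex := by
      rw [← hGc]
      exact Finset.card_erase_lt_of_mem b.2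
    refine Nat.find_min hex hlt ⟨G.erase b.1, rfl, ?_, ?_⟩
    · intro g hg
      exact ⟨dg g, hdg g (Finset.mem_of_mem_erase hg)⟩
    · apply le_antisymm
      · rw [← hGs]
        exact Submodule.span_mono (by exact_mod_cast Finset.erase_subset _ _)
      · rw [← hGs, Submodule.span_le]
        intro g hg
        by_cases hgb : g = b.1
        · rw [hgb]; exact hb
        · exact Submodule.subset_span (by
            rw [Finset.mem_coe, Finset.mem_erase]; exact ⟨hgb, hg⟩)

/-- state of the construction of a minimal resolution -/
structure St (K : Type) [Field K] (σ : Type) where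
  ι : Type
  fin : Finite ι
  deg : ι → ℕ
  N : Submodule (MvPolynomial σ K) (ι →₀ MvPolynomial σ K)
  hN : CompC deg N

lemma St.exists_next [Finite σ] (s : St K σ) : ∃ (t : St K σ)
    (D : (t.ι →₀ MvPolynomial σ K) →ₗ[MvPolynomial σ K] (s.ι →₀ MvPolynomial σ K)),
    LinearMap.range D = s.N ∧ HomM t.deg s.deg 0 D ∧ LinearMap.ker D = t.N ∧
      ∀ x ∈ t.N, ∀ b, constantCoeff (x b) = 0 := by
  have := s.fin
  obtain ⟨ι', hf, deg', D, h1, h2, h3⟩ := res_step s.deg s.N s.hN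
  refine ⟨⟨ι', hf, deg', LinearMap.ker D, ?_⟩, D, h1, h2, rfl, fun x hx => h3 x hx⟩
  intro x hx e
  rw [LinearMap.mem_ker] at hx ⊢
  rw [← comp_map h2, hx, comp_zero]

theorem exists_minimal [Finite σ] (I : Ideal (MvPolynomial σ K))
    (hI : ∀ p ∈ I, ∀ e, pj 0 e p ∈ I) : Nonempty (MinimalGradedFreeResolution I) := by
  choose nx D h1 h2 h3 h4 using fun s : St K σ => s.exists_next
  let s0 : St K σ := ⟨Unit, inferInstance, fun _ => 0,
    Submodule.comap (Finsupp.lapply ()) I, by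
      intro x hx e
      exact hI _ hx e⟩
  let st : ℕ → St K σ := fun i => Nat.rec s0 (fun _ s => nx s) i
  have hst : ∀ i, st (i + 1) = nx (st i) := fun i => rfl
  have hhom : ∀ i b c, ((D (st i) (Finsupp.single b 1)) c) = 0 ∨
      ((st i).deg c ≤ (nx (st i)).deg b ∧
        ((D (st i) (Finsupp.single b 1)) c).IsHomogeneous ((nx (st i)).deg b - (st i).deg c)) := by
    intro i b c
    by_cases h0 : (D (st i) (Finsupp.single b 1)) c = 0
    · exact Or.inl h0
    · right
      obtain ⟨α, hα⟩ := exists_coeff_ne_zero h0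
      have hh := h2 (st i) b c
      refine ⟨by have := hh α hα; omega, ?_⟩
      intro β hβ
      have := hh β hβ
      have hw : Finsupp.weight 1 β = β.degree := by
        rw [Finsupp.degree_eq_weight_one]; rfl
      rw [hw]
      omega
  refine ⟨{ ι := fun i => (st (i + 1)).ι
            finite := fun i => (st (i + 1)).fin
            deg := fun i => (st (i + 1)).deg
            d := fun i => D (st (i + 1))
            ε := (Finsupp.lapply ()) ∘ₗ D s0
            range_ε := ?_
            exact_ε := ?_
            exact_d := ?_
            homog_ε := ?_
            homog_d := fun i b c => hhom (i + 1) b c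
            minimal := ?_ }⟩
  · rw [LinearMap.range_comp, h1]
    apply Submodule.map_comap_eq_of_surjective
    intro p
    exact ⟨Finsupp.single () p, by simp⟩
  · change _ = LinearMap.range (D (nx s0))
    rw [h1, ← h3]
    ext x
    rw [LinearMap.mem_ker, LinearMap.mem_ker]
    constructor
    · intro h
      ext1
      exact h
    · intro h
      rw [LinearMap.comp_apply, h, map_zero]
  · intro i
    change LinearMap.ker (D (st (i + 1))) = LinearMap.range (D (nx (st (i + 1))))
    rw [h1, h3]
  · intro b
    rcases hhom 0 b () with h | h
    · change MvPolynomial.IsHomogeneous ((D (st 0) (Finsupp.single b 1)) ()) _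
      rw [h]
      exact isHomogeneous_zero _ _ _
    · exact h.2
  · intro i b c
    apply h4 (st i)
    change _ ∈ (st (i + 1)).N
    rw [← h1 (st (i + 1))]
    exact ⟨_, rfl⟩

end Cyc

end

noncomputable section

namespace Cyc

variable {K : Type} [Field K] {σ : Type} {I : Ideal (MvPolynomial σ K)}

/-- generators of the resolution of the quotient -/
def Rι (R : MinimalGradedFreeResolution I) : ℕ → Type
  | 0 => Unit
  | i + 1 => R.ι i

/-- degrees -/
def Rdeg (R : MinimalGradedFreeResolution I) : ∀ i, Rι R i → ℕ
  | 0 => fun _ => 0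
  | i + 1 => R.deg i

/-- differentials -/
def Rd (R : MinimalGradedFreeResolution I) : ∀ i,
    (Rι R (i + 1) →₀ MvPolynomial σ K) →ₗ[MvPolynomial σ K] (Rι R i →₀ MvPolynomial σ K)
  | 0 => (Finsupp.lsingle () : MvPolynomial σ K →ₗ[MvPolynomial σ K] (Unit →₀ MvPolynomial σ K))
      ∘ₗ R.ε
  | i + 1 => R.d i

lemma mem_I_iff (R : MinimalGradedFreeResolution I) (p : MvPolynomial σ K) :
    p ∈ I ↔ ∃ y, R.ε y = p := by
  have h : p ∈ LinearMap.range R.ε ↔ p ∈ I := by rw [R.range_ε]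
  exact h.symm

lemma Rd_ker (R : MinimalGradedFreeResolution I) :
    LinearMap.ker ((Finsupp.lsingle () :
      MvPolynomial σ K →ₗ[MvPolynomial σ K] (Unit →₀ MvPolynomial σ K)) ∘ₗ R.ε) =
      LinearMap.range (R.d 0) := by
  rw [← R.exact_ε]
  ext x
  rw [LinearMap.mem_ker, LinearMap.mem_ker]
  exact Finsupp.single_eq_zero

lemma Rd_zero (R : MinimalGradedFreeResolution I) (x) :
    Rd R 0 x = Finsupp.single () (R.ε x) := rfl

lemma weight_one (β : σ →₀ ℕ) : Finsupp.weight 1 β = β.degree := by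
  rw [Finsupp.degree_eq_weight_one]; rfl

/-- the resolution of the quotient attached to a minimal resolution of `I` -/
def toGC (R : MinimalGradedFreeResolution I) : GC K σ where
  ι := Rι R
  deg := Rdeg R
  d := Rd R
  exact := by
    intro i
    cases i with
    | zero =>
      exact Rd_ker R
    | succ i => exact R.exact_d i
  hom := by
    intro i
    cases i with
    | zero =>
      intro b c α hα
      have hα' : coeff α (R.ε (Finsupp.single b 1)) ≠ 0 := by
        have : Rd R 0 (Finsupp.single b 1) c = R.ε (Finsupp.single b 1) := by
          rw [Rd_zero]
          exact Finsupp.single_eq_same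
        rwa [this] at hα
      have := R.homog_ε b hα'
      rw [weight_one] at this
      exact this
    | succ i =>
      intro b c α hα
      rcases R.homog_d i b c with h | ⟨h1, h2⟩
      · exact absurd (show coeff α ((R.d i (Finsupp.single b 1)) c) = 0 by rw [h]; simp) hα
      · have := h2 hα
        rw [weight_one] at this
        change α.degree + R.deg i c = R.deg (i + 1) b + 0
        omega
  u := ()
  uniq := fun _ => rfl
  deg_u := rfl

lemma toGC_res (R : MinimalGradedFreeResolution I) : (toGC R).Res I := by
  intro x
  change (∃ y, Finsupp.single () (R.ε y) = x) ↔ x () ∈ I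
  rw [mem_I_iff R]
  constructor
  · rintro ⟨y, rfl⟩
    exact ⟨y, Finsupp.single_eq_same.symm⟩
  · rintro ⟨y, hy⟩
    refine ⟨y, ?_⟩
    rw [hy]
    exact ((toGC R).single_u x).symm

lemma toGC_min (R : MinimalGradedFreeResolution I) (hI : ∀ p ∈ I, constantCoeff p = 0) (i : ℕ)
    (b : (toGC R).ι (i + 1)) (c : (toGC R).ι i) :
    constantCoeff ((toGC R).d i (Finsupp.single b 1) c) = 0 := by
  cases i with
  | zero =>
    have : (toGC R).d 0 (Finsupp.single b 1) c = R.ε (Finsupp.single b 1) :=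
      Finsupp.single_eq_same
    rw [this]
    apply hI
    exact (mem_I_iff R _).2 ⟨_, rfl⟩
  | succ i => exact R.minimal i b c

theorem betti_le (hI : ∀ p ∈ I, constantCoeff p = 0) (R R' : MinimalGradedFreeResolution I)
    (i j : ℕ) : R.betti i j ≤ R'.betti i j := by
  obtain ⟨f⟩ := rigidity (toGC R) (toGC R') (toGC_res R) (toGC_res R') i j
    (fun e c _ => toGC_min R hI _ _ _) (fun e c _ => toGC_min R hI _ _ _)
  have := R'.finite i
  exact Nat.card_le_card_of_injective (β := {b : R'.ι i // R'.deg i b = j}) f f.injective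

theorem betti_ne_zero_iff (R : MinimalGradedFreeResolution I) (i j : ℕ) :
    R.betti i j ≠ 0 ↔ ∃ b, R.deg i b = j := by
  have := R.finite i
  unfold MinimalGradedFreeResolution.betti
  rw [Nat.card_ne_zero]
  constructor
  · rintro ⟨⟨b, hb⟩, _⟩
    exact ⟨b, hb⟩
  · rintro ⟨b, hb⟩
    exact ⟨⟨b, hb⟩, inferInstance⟩

theorem betti_upper {n : ℕ} (hn : 3 < n)
    (hI : ∀ p ∈ edgeIdeal K (SimpleGraph.cycleGraph n)ᶜ, constantCoeff p = 0)
    (R : MinimalGradedFreeResolution (edgeIdeal K (SimpleGraph.cycleGraph n)ᶜ)) (i j : ℕ)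
    (h : R.betti i j ≠ 0) : j ≤ i + 3 := by
  obtain ⟨E, hE, hd, -⟩ := exists_E (K := K) hn
  obtain ⟨b, hb⟩ := (betti_ne_zero_iff R i j).1 h
  obtain ⟨f⟩ := rigidity (toGC R) E (toGC_res R) hE i j
    (fun e c _ => toGC_min R hI _ _ _) (fun e c _ => toGC_min R hI _ _ _)
  obtain ⟨e, he⟩ := f ⟨b, hb⟩
  have := hd _ e
  omega

theorem betti_lower {n : ℕ} (hn : 3 < n)
    (R : MinimalGradedFreeResolution (edgeIdeal K (SimpleGraph.cycleGraph n)ᶜ)) :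
    R.betti (n - 3) n ≠ 0 := by
  obtain ⟨E, hE, hd, e, he⟩ := exists_E (K := K) hn
  obtain ⟨m, rfl⟩ : ∃ m, n = m + 3 := ⟨n - 3, by omega⟩
  have hm : m + 3 - 2 = m + 1 := by omega
  have hm' : m + 3 - 3 = m := by omega
  rw [hm']
  obtain ⟨e, he⟩ : ∃ e, E.deg (m + 1) e = m + 3 := ⟨e, he⟩
  obtain ⟨f⟩ := rigidity E (toGC R) hE (toGC_res R) m (m + 3)
    (fun e c _ => by have := hd _ c; omega)
    (fun e c h => by
      apply constCoeff_hom (E.hom m)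
      have := hd _ c
      omega)
  obtain ⟨b, hb⟩ := f ⟨e, he⟩
  exact (betti_ne_zero_iff R _ _).2 ⟨b, hb⟩

end Cyc

end
/-- for a cycle `C` of length `n > 3`, `reg I(C̄) = 3`; in particular
`I(C̄)` does not have a (2-)linear resolution. -/
theorem stmt15 (K : Type) [Field K] (n : ℕ) (hn : 3 < n) :
    reg (edgeIdeal K (SimpleGraph.cycleGraph n)ᶜ) = 3 ∧
    ¬ HasLinearResolution (edgeIdeal K (SimpleGraph.cycleGraph n)ᶜ) 2 := by
  have hI : ∀ p ∈ edgeIdeal K (SimpleGraph.cycleGraph n)ᶜ, constantCoeff p = 0 := by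
    intro p hp
    by_contra h
    rw [constantCoeff_eq] at h
    obtain ⟨i, j, _, h1, _⟩ := (Cyc.mem_edgeIdeal_iff _ p).1 hp 0 h
    exact h1 rfl
  obtain ⟨R0⟩ := Cyc.exists_minimal (edgeIdeal K (SimpleGraph.cycleGraph n)ᶜ) (by
    intro p hp e
    rw [Cyc.mem_edgeIdeal_iff] at hp ⊢
    intro α hα
    apply hp
    rw [Cyc.coeff_pj] at hα
    intro h
    rw [h] at hα
    simp at hα)
  have hb : ∀ i j, bettiNumber (edgeIdeal K (SimpleGraph.cycleGraph n)ᶜ) i j = R0.betti i j := by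
    intro i j
    unfold bettiNumber
    have : {b | ∃ R : MinimalGradedFreeResolution (edgeIdeal K (SimpleGraph.cycleGraph n)ᶜ),
        R.betti i j = b} = {R0.betti i j} := by
      ext b
      constructor
      · rintro ⟨R, rfl⟩
        exact le_antisymm (Cyc.betti_le hI R R0 i j) (Cyc.betti_le hI R0 R i j)
      · rintro rfl
        exact ⟨R0, rfl⟩
    rw [this]
    exact csSup_singleton _
  constructor
  · unfold reg
    refine IsGreatest.csSup_eq ⟨⟨n - 3, n, ?_, by omega⟩, ?_⟩
    · rw [hb]
      exact Cyc.betti_lower hn R0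
    · rintro r ⟨i, j, h, rfl⟩
      rw [hb] at h
      have := Cyc.betti_upper hn hI R0 _ _ h
      omega
  · rintro ⟨R, hR⟩
    have := hR _ _ (Cyc.betti_lower hn R)
    omega
end

section
/- If G is a graph that is not chordal, then the edge ideal I(Ḡ) of its complement does not have a linear resolution. -/
open MvPolynomial

/-- `G` has an induced cycle of length `m`: an embedded `m`-cycle with no chords. -/
def HasInducedCycle {V : Type} (G : SimpleGraph V) (m : ℕ) : Prop :=
  ∃ f : ZMod m ↪ V, ∀ u v : ZMod m,
    G.Adj (f u) (f v) ↔ (u ≠ v ∧ (u - v = 1 ∨ v - u = 1))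

/-- A graph is chordal if it has no induced cycle of length at least 4. -/
def IsChordal {V : Type} (G : SimpleGraph V) : Prop :=
  ∀ m : ℕ, 4 ≤ m → ¬ HasInducedCycle G m


section Helpers
variable {K : Type} [Field K] {n : ℕ}

/-- Koszul sign. -/
def sg (t : Fin n) (T : Finset (Fin n)) : ℤ := (-1) ^ (T.filter (· < t)).card

lemma sg_mul_self (t : Fin n) (T : Finset (Fin n)) : sg t T * sg t T = 1 := by
  unfold sg
  rw [← mul_pow]; simp

lemma sg_swap {a b : Fin n} {T : Finset (Fin n)} (hab : a ≠ b) (ha : a ∉ T) (hb : b ∉ T) :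
    sg a T * sg b (insert a T) = - (sg b T * sg a (insert b T)) := by
  unfold sg
  rcases lt_or_gt_of_ne hab with h | h
  · rw [Finset.filter_insert, if_pos h, Finset.filter_insert, if_neg (by omega),
      Finset.card_insert_of_notMem (by simp [ha]), pow_succ]
    ring
  · rw [Finset.filter_insert, if_neg (by omega), Finset.filter_insert, if_pos h,
      Finset.card_insert_of_notMem (by simp [hb]), pow_succ]
    ring

/-- Koszul differential. -/
noncomputable def kd (K : Type) [Field K] {n : ℕ} {M : Type} [AddCommGroup M]
    [Module (MvPolynomial (Fin n) K) M]
    (z : Finset (Fin n) → M) (T : Finset (Fin n)) : M :=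
  ∑ t ∈ Tᶜ, sg t T • ((X t : MvPolynomial (Fin n) K) • z (insert t T))

variable {M N : Type} [AddCommGroup M] [Module (MvPolynomial (Fin n) K) M]
  [AddCommGroup N] [Module (MvPolynomial (Fin n) K) N]

lemma kd_kd (z : Finset (Fin n) → M) (T : Finset (Fin n)) : kd K (kd K z) T = 0 := by
  unfold kd
  simp only [Finset.smul_sum]
  rw [Finset.sum_sigma']
  refine Finset.sum_involution (fun p _ => ⟨p.2, p.1⟩) ?_ ?_ ?_ ?_
  · rintro ⟨t, s⟩ h
    simp only [Finset.mem_sigma, Finset.mem_compl, Finset.mem_insert, not_or] at h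
    obtain ⟨ht, hst, hs⟩ := h
    simp only
    rw [Finset.insert_comm t s, smul_comm (X t : MvPolynomial (Fin n) K) (sg s (insert t T)),
      smul_comm (X s : MvPolynomial (Fin n) K) (sg t (insert s T)),
      smul_comm (X t : MvPolynomial (Fin n) K) (X s : MvPolynomial (Fin n) K),
      smul_smul (sg t T), smul_smul (sg s T), ← add_smul,
      sg_swap (Ne.symm hst) ht hs]
    simp
  · rintro ⟨t, s⟩ h _ he
    simp only [Finset.mem_sigma, Finset.mem_compl, Finset.mem_insert, not_or] at h
    simp only [Sigma.mk.injEq, heq_eq_eq] at he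
    exact h.2.1 he.1
  · rintro ⟨t, s⟩ h
    simp only [Finset.mem_sigma, Finset.mem_compl, Finset.mem_insert, not_or] at h ⊢
    exact ⟨h.2.2, fun e => h.2.1 e.symm, h.1⟩
  · rintro ⟨t, s⟩ h
    rfl

lemma kd_map (φ : M →ₗ[MvPolynomial (Fin n) K] N) (z : Finset (Fin n) → M)
    (T : Finset (Fin n)) : φ (kd K z T) = kd K (fun U => φ (z U)) T := by
  simp [kd, map_sum, map_zsmul]

lemma kd_congr {z w : Finset (Fin n) → M} {T : Finset (Fin n)}
    (h : ∀ U : Finset (Fin n), U.card = T.card + 1 → z U = w U) : kd K z T = kd K w T := by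
  unfold kd
  refine Finset.sum_congr rfl fun t ht => ?_
  rw [h]
  rw [Finset.card_insert_of_notMem (by simpa using ht)]

lemma kd_sub (z w : Finset (Fin n) → M) (T : Finset (Fin n)) :
    kd K (fun U => z U - w U) T = kd K z T - kd K w T := by
  simp [kd, smul_sub, Finset.sum_sub_distrib]

/-- Setting the first `k` variables to zero. -/
noncomputable def killBelow (k : ℕ) :
    MvPolynomial (Fin n) K →ₐ[K] MvPolynomial (Fin n) K :=
  aeval (fun j : Fin n => if j.val < k then 0 else X j)

noncomputable def divX (i : Fin n) : MvPolynomial (Fin n) K →+ MvPolynomial (Fin n) K :=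
  AddMonoidHom.mk' (fun f => f.divMonomial (Finsupp.single i 1))
    (fun f g => add_divMonomial f g _)

lemma coeff_divX (i : Fin n) (f : MvPolynomial (Fin n) K) (s : Fin n →₀ ℕ) :
    coeff s (divX i f) = coeff (Finsupp.single i 1 + s) f := by
  simp [divX]

lemma divX_X_mul (i : Fin n) (f : MvPolynomial (Fin n) K) : divX i (X i * f) = f := by
  ext s
  rw [coeff_divX, coeff_X_mul]

lemma divX_X_mul_of_ne {i j : Fin n} (h : j ≠ i) (f : MvPolynomial (Fin n) K) :
    divX i (X j * f) = X j * divX i f := by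
  ext s
  rw [coeff_divX, coeff_X_mul', coeff_X_mul']
  have : (j ∈ (Finsupp.single i 1 + s).support) ↔ j ∈ s.support := by
    simp [Finsupp.single_apply, h.symm]
  simp only [this, coeff_divX]
  split_ifs with h2
  · congr 1
    ext k
    simp only [Finsupp.coe_tsub, Finsupp.coe_add, Pi.sub_apply, Pi.add_apply, Finsupp.single_apply]
    have := Finsupp.mem_support_iff.1 h2
    split_ifs with h3 h4 <;> subst_vars <;> first | omega | (exact absurd rfl h)
  · rfl

lemma divX_C (i : Fin n) (a : K) : divX i (C a : MvPolynomial (Fin n) K) = 0 := by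
  ext s
  rw [coeff_divX, coeff_C, if_neg]
  · simp
  · intro h
    have := DFunLike.congr_fun h i
    simp at this
    omega

lemma split_var (i : Fin n) (g : MvPolynomial (Fin n) K) :
    g = aeval (fun j : Fin n => if j = i then (0 : MvPolynomial (Fin n) K) else X j) g
      + X i * divX i g := by
  induction g using MvPolynomial.induction_on with
  | C a => rw [divX_C]; simp [algebraMap_eq]
  | add p q hp hq =>
    rw [map_add, map_add, mul_add]
    nth_rewrite 1 [hp, hq]
    ring
  | mul_X p j hp =>
    by_cases h : j = i
    · subst h
      rw [mul_comm p, divX_X_mul]; simp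
    · rw [mul_comm p, divX_X_mul_of_ne h, map_mul, aeval_X, if_neg h]
      nth_rewrite 1 [hp]
      ring

lemma killBelow_step (i : Fin n) (f : MvPolynomial (Fin n) K) :
    killBelow i.val f = killBelow (i.val + 1) f + X i * divX i (killBelow i.val f) := by
  conv_lhs => rw [split_var i (killBelow i.val f)]
  congr 1
  rw [← AlgHom.comp_apply]
  congr 1
  apply MvPolynomial.algHom_ext
  intro j
  simp only [killBelow, AlgHom.comp_apply, aeval_X]
  by_cases h1 : j.val < i.val
  · rw [if_pos h1, if_pos (by omega)]; simp
  · by_cases h2 : j = i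
    · subst h2; simp
    · rw [if_neg h1, if_neg (by intro h; apply h2; apply Fin.ext; omega), aeval_X, if_neg h2]

noncomputable def hX (i : Fin n) : MvPolynomial (Fin n) K →+ MvPolynomial (Fin n) K :=
  (divX i).comp (killBelow i.val : MvPolynomial (Fin n) K →ₐ[K] _).toRingHom.toAddMonoidHom

lemma hX_apply (i : Fin n) (f : MvPolynomial (Fin n) K) :
    hX i f = divX i (killBelow i.val f) := rfl

lemma killBelow_zero (f : MvPolynomial (Fin n) K) : killBelow 0 f = f := by
  simp [killBelow, aeval_X_left]

lemma telescoping (f : MvPolynomial (Fin n) K) (k : ℕ) (hk : k ≤ n) :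
    f = killBelow k f + ∑ t : Fin n with t.val < k, X t * hX t f := by
  induction k with
  | zero => simp [killBelow_zero]
  | succ k ih =>
    have h1 := ih (by omega)
    have h2 := killBelow_step ⟨k, hk⟩ f
    have h3 : (Finset.univ.filter (fun t : Fin n => t.val < k + 1)) =
        insert ⟨k, hk⟩ (Finset.univ.filter (fun t : Fin n => t.val < k)) := by
      ext t
      simp [Fin.ext_iff]
      omega
    rw [h3, Finset.sum_insert (by simp), ← add_assoc, hX_apply]
    simp only at h2
    rw [← h2]
    exact h1

lemma hX_X_self (i : Fin n) (f : MvPolynomial (Fin n) K) :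
    hX i (X i * f) = killBelow i.val f := by
  rw [hX_apply, map_mul]
  have : killBelow i.val (X i : MvPolynomial (Fin n) K) = X i := by simp [killBelow]
  rw [this, divX_X_mul]

lemma hX_X_lt {i t : Fin n} (h : t < i) (f : MvPolynomial (Fin n) K) :
    hX i (X t * f) = 0 := by
  rw [hX_apply, map_mul]
  have : killBelow i.val (X t : MvPolynomial (Fin n) K) = 0 := by
    simp [killBelow, h]
  rw [this]; simp

lemma hX_X_gt {i t : Fin n} (h : i < t) (f : MvPolynomial (Fin n) K) :
    hX i (X t * f) = X t * hX i f := by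
  rw [hX_apply, map_mul]
  have : killBelow i.val (X t : MvPolynomial (Fin n) K) = X t := by
    simp [killBelow]; intro h'; omega
  rw [this, divX_X_mul_of_ne h.ne', hX_apply]

/-- contracting homotopy -/
noncomputable def hom {M : Type} [AddCommGroup M] (H : Fin n → M →+ M)
    (z : Finset (Fin n) → M) (T : Finset (Fin n)) : M :=
  if h : T.Nonempty then H (T.min' h) (z (T.erase (T.min' h))) else 0

lemma hom_insert {M : Type} [AddCommGroup M] (H : Fin n → M →+ M)
    (z : Finset (Fin n) → M) (T : Finset (Fin n)) (i : Fin n) (h : ∀ j ∈ T, i < j) :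
    hom H z (insert i T) = H i (z T) := by
  have hne : (insert i T).Nonempty := ⟨i, by simp⟩
  have hm : (insert i T).min' hne = i := by
    apply le_antisymm
    · exact Finset.min'_le _ _ (by simp)
    · apply Finset.le_min'
      intro y hy
      rcases Finset.mem_insert.1 hy with rfl | hy
      · exact le_rfl
      · exact (h y hy).le
  rw [hom, dif_pos hne, hm, Finset.erase_insert]
  intro hi; exact lt_irrefl _ (h i hi)

lemma koszul_exact_ring (z : Finset (Fin n) → MvPolynomial (Fin n) K)
    (T : Finset (Fin n)) (i : Fin n) (hi : ∀ j ∈ T, i < j) (hz : kd K z T = 0) :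
    kd K (hom hX z) (insert i T) = z (insert i T) := by
  have hiT : i ∉ T := fun h => lt_irrefl _ (hi i h)
  have h0 : hX i (kd K z T) = 0 := by rw [hz, map_zero]
  unfold kd at h0 ⊢
  rw [map_sum] at h0
  have hc : Tᶜ = insert i (insert i T)ᶜ := by
    ext t
    by_cases h : t = i
    · subst h; simp [hiT]
    · simp [h]
  rw [hc, Finset.sum_insert (by simp)] at h0
  have hsg : sg i T = 1 := by
    unfold sg
    rw [Finset.filter_false_of_mem]
    · simp
    · intro j hj; have := hi j hj; omega
  simp only [map_zsmul, hsg, one_smul, smul_eq_mul] at h0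
  rw [hX_X_self] at h0
  have ht := telescoping (z (insert i T)) i.val (by omega)
  have hsub : (Finset.univ.filter (fun t : Fin n => t.val < i.val)) ⊆ (insert i T)ᶜ := by
    intro t ht
    simp only [Finset.mem_filter, Finset.mem_univ, true_and] at ht
    simp only [Finset.mem_compl, Finset.mem_insert, not_or]
    refine ⟨by intro h; subst h; omega, fun h => ?_⟩
    have := hi t h
    omega
  have key : ∑ t ∈ (insert i T)ᶜ, sg t (insert i T) •
        ((X t : MvPolynomial (Fin n) K) • hom hX z (insert t (insert i T)))
      + ∑ t ∈ (insert i T)ᶜ, sg t T • hX i (X t * z (insert t T))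
      = ∑ t : Fin n with t.val < i.val, X t * hX t (z (insert i T)) := by
    rw [← Finset.sum_add_distrib]
    symm
    rw [← Finset.sum_subset hsub]
    · refine Finset.sum_congr rfl fun t ht => ?_
      simp only [Finset.mem_filter, Finset.mem_univ, true_and] at ht
      have htl : t < i := ht
      have hlt : ∀ j ∈ insert i T, t < j := by
        intro j hj
        rcases Finset.mem_insert.1 hj with rfl | hj
        · exact htl
        · exact htl.trans (hi j hj)
      rw [hom_insert _ _ _ _ hlt, hX_X_lt htl]
      have : sg t (insert i T) = 1 := by
        unfold sg
        rw [Finset.filter_false_of_mem]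
        · simp
        · intro j hj; have := hlt j hj; omega
      simp [this]
    · intro t ht hnt
      simp only [Finset.mem_filter, Finset.mem_univ, true_and] at hnt
      simp only [Finset.mem_compl, Finset.mem_insert, not_or] at ht
      have hit : i < t := by
        rcases lt_trichotomy t i with h | h | h
        · exact absurd h hnt
        · exact absurd h ht.1
        · exact h
      rw [Finset.insert_comm, hom_insert _ _ (insert t T) i, hX_X_gt hit, smul_eq_mul]
      · have h1 := sg_swap (T := T) hit.ne hiT ht.2
        have h2 : sg i (insert t T) = 1 := by
          unfold sg
          rw [Finset.filter_false_of_mem]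
          · simp
          · intro j hj
            rcases Finset.mem_insert.1 hj with rfl | hj
            · omega
            · have := hi j hj; omega
        rw [hsg, h2, one_mul, mul_one] at h1
        rw [h1, neg_smul]
        simp
      · intro j hj
        rcases Finset.mem_insert.1 hj with rfl | hj
        · exact hit
        · exact hi j hj
  rw [← sub_eq_zero]
  rw [← eq_sub_iff_add_eq] at key
  rw [key]
  nth_rewrite 2 [ht]
  linear_combination -h0

lemma koszul_exact {ι : Type} (p : ℕ) (z : Finset (Fin n) → (ι →₀ MvPolynomial (Fin n) K))
    (hz : ∀ T : Finset (Fin n), T.card = p → kd K z T = 0) :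
    ∃ v : Finset (Fin n) → (ι →₀ MvPolynomial (Fin n) K),
      ∀ T : Finset (Fin n), T.card = p + 1 → kd K v T = z T := by
  refine ⟨hom (fun i => Finsupp.mapRange.addMonoidHom (hX i)) z, fun T hT => ?_⟩
  have hne : T.Nonempty := by rw [← Finset.card_pos]; omega
  set i := T.min' hne with hi
  have hiT : i ∈ T := Finset.min'_mem _ _
  have hlt : ∀ j ∈ T.erase i, i < j := by
    intro j hj
    have := Finset.mem_erase.1 hj
    exact lt_of_le_of_ne (Finset.min'_le _ _ this.2) (Ne.symm this.1)
  have hins : insert i (T.erase i) = T := Finset.insert_erase hiT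
  ext1 b
  have h1 := kd_map (K := K) (Finsupp.lapply b : (ι →₀ MvPolynomial (Fin n) K) →ₗ[_] _)
    (hom (fun i => Finsupp.mapRange.addMonoidHom (hX i)) z) T
  have h2 := kd_map (K := K) (Finsupp.lapply b : (ι →₀ MvPolynomial (Fin n) K) →ₗ[_] _)
    z (T.erase i)
  rw [hz _ (by rw [Finset.card_erase_of_mem hiT]; omega), map_zero] at h2
  have h3 := koszul_exact_ring _ _ i hlt h2.symm
  rw [hins] at h3
  simp only [Finsupp.lapply_apply] at h1 h3
  rw [h1, ← h3]
  congr 1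
  ext1 U
  unfold hom
  split_ifs
  · simp
  · simp

/-- `m N` -/
noncomputable def mS (N : Submodule (MvPolynomial (Fin n) K) M) :
    Submodule (MvPolynomial (Fin n) K) M :=
  (Submodule.pi Set.univ (fun _ : Fin n => N)).map
    (∑ t : Fin n, (X t : MvPolynomial (Fin n) K) •
      (LinearMap.proj t : (Fin n → M) →ₗ[MvPolynomial (Fin n) K] M))

lemma mem_mS {P : Submodule (MvPolynomial (Fin n) K) M} {x : M} :
    x ∈ mS P ↔ ∃ y : Fin n → M, (∀ t, y t ∈ P) ∧
      ∑ t, (X t : MvPolynomial (Fin n) K) • y t = x := by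
  simp [mS, Submodule.mem_map, Submodule.mem_pi, LinearMap.sum_apply]

lemma X_smul_mem_mS {P : Submodule (MvPolynomial (Fin n) K) M} {x : M} (t : Fin n)
    (hx : x ∈ P) : (X t : MvPolynomial (Fin n) K) • x ∈ mS P := by
  rw [mem_mS]
  refine ⟨Pi.single t x, fun s => ?_, ?_⟩
  · by_cases h : s = t
    · subst h; simpa using hx
    · simp [Pi.single_eq_of_ne h]
  · rw [Finset.sum_eq_single t]
    · simp
    · intro s _ h; simp [Pi.single_eq_of_ne h]
    · simp

lemma kd_mem_mS {P : Submodule (MvPolynomial (Fin n) K) M} {z : Finset (Fin n) → M}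
    {T : Finset (Fin n)} (h : ∀ U : Finset (Fin n), U.card = T.card + 1 → z U ∈ P) :
    kd K z T ∈ mS P := by
  unfold kd
  refine Submodule.sum_mem _ fun t ht => ?_
  refine zsmul_mem (X_smul_mem_mS t (h _ ?_)) _
  rw [Finset.card_insert_of_notMem (by simpa using ht)]

lemma mS_map_mem (φ : M →ₗ[MvPolynomial (Fin n) K] N)
    {P : Submodule (MvPolynomial (Fin n) K) M} {Q : Submodule (MvPolynomial (Fin n) K) N}
    (h : ∀ x ∈ P, φ x ∈ Q) {x : M} (hx : x ∈ mS P) : φ x ∈ mS Q := by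
  rw [mem_mS] at hx ⊢
  obtain ⟨y, hy, rfl⟩ := hx
  exact ⟨fun t => φ (y t), fun t => h _ (hy t), by simp⟩

lemma coeff_mS_mS {f : MvPolynomial (Fin n) K}
    (hf : f ∈ mS (K := K) (n := n) (mS (⊤ : Submodule (MvPolynomial (Fin n) K) (MvPolynomial (Fin n) K))))
    (s : Fin n →₀ ℕ) (hs : s.degree = 1) : coeff s f = 0 := by
  rw [mem_mS] at hf
  obtain ⟨y, hy, rfl⟩ := hf
  rw [coeff_sum]
  refine Finset.sum_eq_zero fun t _ => ?_
  obtain ⟨g, -, hg⟩ := mem_mS.1 (hy t)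
  rw [smul_eq_mul, coeff_X_mul']
  split_ifs with h
  · have h0 : s - Finsupp.single t 1 = 0 := by
      have h2 : (s - Finsupp.single t 1) + Finsupp.single t 1 = s := by
        ext k
        simp only [Finsupp.coe_add, Finsupp.coe_tsub, Pi.add_apply, Pi.sub_apply,
          Finsupp.single_apply]
        have := Finsupp.mem_support_iff.1 h
        split_ifs with h3
        · subst h3; omega
        · omega
      have h3 := congrArg Finsupp.degree h2
      rw [map_add, hs, Finsupp.degree_single] at h3
      rw [← Finsupp.degree_eq_zero_iff]; omega
    rw [h0, ← hg, coeff_sum]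
    refine Finset.sum_eq_zero fun u _ => ?_
    rw [smul_eq_mul, coeff_X_mul', if_neg (by simp)]
  · rfl

lemma sub_const_mem {ι : Type} (f : ι →₀ MvPolynomial (Fin n) K) :
    f - f.mapRange (fun p => C (constantCoeff p)) (by simp) ∈
      mS (⊤ : Submodule (MvPolynomial (Fin n) K) (ι →₀ MvPolynomial (Fin n) K)) := by
  rw [mem_mS]
  refine ⟨fun t => Finsupp.mapRange.addMonoidHom (hX t) f, fun _ => trivial, ?_⟩
  ext1 b
  have h := telescoping (f b) n le_rfl
  have h2 : killBelow n (f b) = C (constantCoeff (f b)) := by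
    have : (fun j : Fin n => if j.val < n then (0 : MvPolynomial (Fin n) K) else X j) = 0 := by
      ext1 j; simp
    rw [killBelow, this, aeval_zero, algebraMap_eq]
  rw [h2] at h
  simp only [Fin.is_lt, Finset.filter_true] at h
  simp only [Finsupp.coe_finsetSum, Finset.sum_apply, Finsupp.coe_smul, Pi.smul_apply,
    Finsupp.mapRange.addMonoidHom_apply, Finsupp.mapRange_apply, Finsupp.coe_sub, Pi.sub_apply,
    smul_eq_mul]
  nth_rewrite 2 [h]
  ring

lemma linear_key {ι κ : Type} (d : (ι →₀ MvPolynomial (Fin n) K) →ₗ[MvPolynomial (Fin n) K]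
      (κ →₀ MvPolynomial (Fin n) K))
    (lin : ∀ b c, (d (Finsupp.single b 1) c).IsHomogeneous 1)
    (f : ι →₀ MvPolynomial (Fin n) K) (hf : d f ∈ mS (K := K) (n := n) (mS ⊤)) :
    d f ∈ mS (LinearMap.range d) := by
  have h1 := sub_const_mem f
  set f0 := f.mapRange (fun p => C (constantCoeff p)) (by simp) with hf0
  have h2 : d (f - f0) ∈ mS (LinearMap.range d) :=
    mS_map_mem d (P := ⊤) (fun x _ => LinearMap.mem_range_self d x) h1
  have h3 : d (f - f0) ∈ mS (K := K) (n := n) (mS ⊤) := by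
    refine mS_map_mem d (P := ⊤) ?_ h1
    intro x _
    -- entries of `d` are linear
    have hx : x = x.sum (fun b r => r • Finsupp.single b 1) := by
      conv_lhs => rw [← Finsupp.sum_single x]
      simp
    rw [hx, map_finsuppSum]
    refine Submodule.sum_mem _ fun b _ => ?_
    simp only [map_smul]
    refine Submodule.smul_mem _ _ ?_
    have h5 := sub_const_mem (d (Finsupp.single b 1))
    convert h5 using 1
    rw [eq_comm, sub_eq_self]
    ext1 c
    simp only [Finsupp.mapRange_apply, Finsupp.coe_zero, Pi.zero_apply]
    rw [constantCoeff_eq, (lin b c).coeff_eq_zero (by simp), C_0]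
  have h4 : d f0 ∈ mS (K := K) (n := n) (mS ⊤) := by
    have := Submodule.sub_mem _ hf h3
    rwa [← map_sub, sub_sub_cancel] at this
  have h5 : d f0 = 0 := by
    ext1 c
    have hc : (d f0 c).IsHomogeneous 1 := by
      have hx : f0 = f0.sum (fun b r => r • Finsupp.single b 1) := by
        conv_lhs => rw [← Finsupp.sum_single f0]
        simp
      rw [hx, map_finsuppSum, Finsupp.sum, Finsupp.finsetSum_apply]
      refine MvPolynomial.IsHomogeneous.sum _ _ _ fun b _ => ?_
      rw [map_smul, Finsupp.smul_apply, hf0, Finsupp.mapRange_apply, smul_eq_mul]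
      have := (isHomogeneous_C (Fin n) (constantCoeff (f b))).mul (lin b c)
      rwa [zero_add] at this
    have hm : d f0 c ∈ mS (K := K) (n := n) (mS ⊤) :=
      mS_map_mem (Finsupp.lapply c : (κ →₀ MvPolynomial (Fin n) K) →ₗ[MvPolynomial (Fin n) K] _)
        (fun x hx => mS_map_mem (Finsupp.lapply c) (Q := ⊤) (fun _ _ => trivial) hx) h4
    ext s
    by_cases hs : s.degree = 1
    · exact coeff_mS_mS hm s hs
    · rw [hc.coeff_eq_zero hs]; simp
  have : d f = d (f - f0) := by rw [map_sub, h5, sub_zero]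
  rwa [this]

theorem main_ind (ι : ℕ → Type)
    (d : ∀ i, (ι (i + 1) →₀ MvPolynomial (Fin n) K) →ₗ[MvPolynomial (Fin n) K]
      (ι i →₀ MvPolynomial (Fin n) K))
    (ex : ∀ i, LinearMap.ker (d i) = LinearMap.range (d (i + 1)))
    (lin : ∀ i b c, (d i (Finsupp.single b 1) c).IsHomogeneous 1) :
    ∀ (p q : ℕ) (M : Type) [AddCommGroup M] [Module (MvPolynomial (Fin n) K) M]
      (φ : (ι q →₀ MvPolynomial (Fin n) K) →ₗ[MvPolynomial (Fin n) K] M),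
      LinearMap.ker φ = LinearMap.range (d q) →
      ∀ z : Finset (Fin n) → M, (∀ T, T.card = p → z T ∈ mS (LinearMap.range φ)) →
        (∀ T, T.card + 1 = p → kd K z T = 0) →
        ∃ v : Finset (Fin n) → M, (∀ T, v T ∈ LinearMap.range φ) ∧
          ∀ T, T.card = p → kd K v T = z T := by
  intro p
  induction p with
  | zero =>
    intro q M _ _ φ hφ z hz _
    obtain ⟨y, hy, hyz⟩ := mem_mS.1 (hz ∅ rfl)
    refine ⟨fun T => ∑ t ∈ T, y t, fun T => Submodule.sum_mem _ fun t _ => hy t, ?_⟩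
    intro T hT
    rw [Finset.card_eq_zero] at hT
    subst hT
    rw [← hyz]
    simp [kd, sg]
  | succ p ih =>
    intro q M _ _ φ hφ z hz hcyc
    have hlift : ∀ T : Finset (Fin n), ∃ w : ι q →₀ MvPolynomial (Fin n) K,
        w ∈ mS (⊤ : Submodule (MvPolynomial (Fin n) K) (ι q →₀ MvPolynomial (Fin n) K)) ∧ (T.card = p + 1 → φ w = z T) := by
      intro T
      by_cases hT : T.card = p + 1
      · obtain ⟨y, hy, hyz⟩ := mem_mS.1 (hz T hT)
        choose x hx using hy
        refine ⟨∑ t, (X t : MvPolynomial (Fin n) K) • x t,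
          mem_mS.2 ⟨x, fun _ => trivial, rfl⟩, fun _ => ?_⟩
        rw [map_sum, ← hyz]
        simp [hx]
      · exact ⟨0, Submodule.zero_mem _, fun h => absurd h hT⟩
    choose w hw hwz using hlift
    have h1 : ∀ T : Finset (Fin n), T.card = p → kd K w T ∈ mS (LinearMap.range (d q)) := by
      intro T hT
      have h2 : kd K w T ∈ LinearMap.range (d q) := by
        rw [← hφ, LinearMap.mem_ker, kd_map, ← hcyc T (by omega)]
        exact kd_congr fun U hU => hwz U (by omega)
      have h3 : kd K w T ∈ mS (K := K) (n := n) (mS ⊤) := kd_mem_mS fun U _ => hw U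
      obtain ⟨f, hf⟩ := h2
      rw [← hf] at h3 ⊢
      exact linear_key (d q) (lin q) f h3
    obtain ⟨u, hu, hu2⟩ := ih (q + 1) _ (d q) (ex q) (kd K w) h1 (fun T _ => kd_kd w T)
    obtain ⟨v, hv⟩ := koszul_exact p (fun T => w T - u T) (by
      intro T hT
      rw [kd_sub, hu2 T hT, sub_self])
    refine ⟨fun T => φ (v T), fun T => ⟨_, rfl⟩, fun T hT => ?_⟩
    rw [← kd_map, hv T hT, map_sub, hwz T hT]
    have : φ (u T) = 0 := by
      rw [← LinearMap.mem_ker, hφ]; exact hu T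
    rw [this, sub_zero]

lemma koszul_exact_self (p : ℕ) (y : Finset (Fin n) → MvPolynomial (Fin n) K)
    (hy : ∀ T : Finset (Fin n), T.card = p → kd K y T = 0) :
    ∃ v : Finset (Fin n) → MvPolynomial (Fin n) K,
      ∀ T : Finset (Fin n), T.card = p + 1 → kd K v T = y T := by
  obtain ⟨v, hv⟩ := koszul_exact (ι := Unit) p (fun T => Finsupp.lsingle (R := MvPolynomial (Fin n) K) () (y T)) (by
    intro T hT
    rw [← kd_map, hy T hT, map_zero])
  refine ⟨fun T => Finsupp.lapply (R := MvPolynomial (Fin n) K) () (v T), fun T hT => ?_⟩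
  rw [← kd_map, hv T hT]
  simp

lemma coeff_kd (u : Finset (Fin n) → MvPolynomial (Fin n) K) {T : Finset (Fin n)}
    {a b : Fin n} (hab : a ≠ b) (ha : a ∉ T) (hb : b ∉ T) :
    coeff (Finsupp.single a 1 + Finsupp.single b 1) (kd K u T) =
      sg a T • coeff (Finsupp.single b 1) (u (insert a T)) +
      sg b T • coeff (Finsupp.single a 1) (u (insert b T)) := by
  have hz : ∀ (k : ℤ) (s : Fin n →₀ ℕ) (q : MvPolynomial (Fin n) K),
      coeff s (k • q) = k • coeff s q := fun k s q =>
    map_zsmul (coeffAddMonoidHom s : MvPolynomial (Fin n) K →+ K) k q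
  unfold kd
  rw [coeff_sum, Finset.sum_eq_add a b hab]
  · rw [hz, hz, smul_eq_mul, smul_eq_mul, coeff_X_mul, add_comm (Finsupp.single a 1),
      coeff_X_mul]
  · rintro t - ⟨hta, htb⟩
    rw [hz, smul_eq_mul, coeff_X_mul', if_neg, smul_zero]
    simp [Finsupp.single_apply, hta.symm, htb.symm]
  · intro h; simp [ha] at h
  · intro h; simp [hb] at h

lemma sg_coeff_kd (u : Finset (Fin n) → MvPolynomial (Fin n) K) {T : Finset (Fin n)}
    {a b : Fin n} (hab : a ≠ b) (ha : a ∉ T) (hb : b ∉ T) :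
    (sg a T * sg b (insert a T)) •
      coeff (Finsupp.single a 1 + Finsupp.single b 1) (kd K u T) =
      sg b (insert a T) • coeff (Finsupp.single b 1) (u (insert a T)) -
      sg a (insert b T) • coeff (Finsupp.single a 1) (u (insert b T)) := by
  rw [coeff_kd u hab ha hb, smul_add, smul_smul, smul_smul]
  have h1 : sg a T * sg b (insert a T) * sg a T = sg b (insert a T) := by
    linear_combination (sg b (insert a T)) * sg_mul_self a T
  have h2 : sg a T * sg b (insert a T) * sg b T = - sg a (insert b T) := by
    rw [sg_swap hab ha hb]
    linear_combination -(sg a (insert b T)) * sg_mul_self b T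
  rw [h1, h2, neg_smul, sub_eq_add_neg]

end Helpers

section Helpers2
variable {K : Type} [Field K] {n : ℕ}

lemma coeff_edgeIdeal (H : SimpleGraph (Fin n)) {p : MvPolynomial (Fin n) K}
    (hp : p ∈ edgeIdeal K H) {a b : Fin n} (hab : ¬ H.Adj a b) :
    coeff (Finsupp.single a 1 + Finsupp.single b 1) p = 0 := by
  have hI : edgeIdeal K H = Ideal.span ((fun s : Fin n →₀ ℕ => monomial s (1 : K)) ''
      {s | ∃ i j, H.Adj i j ∧ s = Finsupp.single i 1 + Finsupp.single j 1}) := by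
    unfold edgeIdeal
    congr 1
    ext q
    constructor
    · rintro ⟨i, j, h, rfl⟩
      exact ⟨_, ⟨i, j, h, rfl⟩, by simp [X, monomial_mul]⟩
    · rintro ⟨_, ⟨i, j, h, rfl⟩, rfl⟩
      exact ⟨i, j, h, by simp [X, monomial_mul]⟩
  rw [hI, mem_ideal_span_monomial_image] at hp
  by_contra hne
  obtain ⟨_, ⟨i, j, h, rfl⟩, hle⟩ := hp _ (mem_support_iff.2 hne)
  have hij := h.ne
  have hi := hle i
  have hj := hle j
  simp only [Finsupp.coe_add, Pi.add_apply, Finsupp.single_apply] at hi hj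
  rw [if_pos trivial] at hi
  rw [if_pos trivial] at hj
  by_cases h1 : a = i
  · subst h1
    by_cases h2 : b = j
    · subst h2; exact hab h
    · rw [if_neg hij, if_neg h2] at hj; omega
  · by_cases h2 : b = i
    · subst h2
      by_cases h3 : a = j
      · subst h3; exact hab h.symm
      · rw [if_neg h3, if_neg hij] at hj; omega
    · rw [if_neg h1, if_neg h2] at hi; omega

end Helpers2

/-- if `G` is not chordal, then `I(Ḡ)` does not have a linear resolution. -/
theorem stmt16 (K : Type) [Field K] (n : ℕ) (G : SimpleGraph (Fin n))
    (h : ¬ IsChordal G) :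
    ¬ HasLinearResolution (edgeIdeal K Gᶜ) 2 := by
  rintro ⟨R, hR⟩
  unfold IsChordal at h
  push Not at h
  obtain ⟨m, hm, f, hf⟩ := h
  obtain ⟨p, rfl⟩ : ∃ p, m = p + 3 := ⟨m - 3, by omega⟩
  -- linearity of the differentials
  have hdeg : ∀ i b, R.deg i b = i + 2 := by
    intro i b
    refine hR i _ ?_
    unfold MinimalGradedFreeResolution.betti
    have := R.finite i
    have : Nonempty {c : R.ι i // R.deg i c = R.deg i b} := ⟨⟨b, rfl⟩⟩
    exact Nat.card_ne_zero.2 ⟨inferInstance, inferInstance⟩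
  have lin : ∀ i b c, (R.d i (Finsupp.single b 1) c).IsHomogeneous 1 := by
    intro i b c
    rcases R.homog_d i b c with h0 | ⟨-, h1⟩
    · rw [h0]; exact isHomogeneous_zero _ _ _
    · rw [hdeg, hdeg] at h1
      convert h1 using 1
      omega
  -- arithmetic in `ZMod`
  have hnat : ∀ k : ℕ, 0 < k → k < p + 3 → ((k : ℕ) : ZMod (p + 3)) ≠ 0 := by
    intro k h0 h1 h2
    rw [ZMod.natCast_eq_zero_iff] at h2
    exact absurd (Nat.le_of_dvd h0 h2) (by omega)
  have z1 : (1 : ZMod (p + 3)) ≠ 0 := by simpa using hnat 1 (by omega) (by omega)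
  have z2 : (2 : ZMod (p + 3)) ≠ 0 := by simpa using hnat 2 (by omega) (by omega)
  have z3 : (3 : ZMod (p + 3)) ≠ 0 := by simpa using hnat 3 (by omega) (by omega)
  have hne1 : ∀ i : ZMod (p + 3), f i ≠ f (i + 1) := by
    intro i hi
    have := f.injective hi
    apply z1
    linear_combination -this
  have hadj1 : ∀ i : ZMod (p + 3), ¬ Gᶜ.Adj (f i) (f (i + 1)) := by
    intro i hi
    rw [SimpleGraph.compl_adj] at hi
    apply hi.2
    rw [hf]
    exact ⟨fun h => hi.1 (by rw [← h]), Or.inr (by ring)⟩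
  set W : Finset (Fin n) := Finset.univ.map f with hW
  have hWm : ∀ i, f i ∈ W := fun i => by simp [hW]
  have hWc : W.card = p + 3 := by simp [hW, ZMod.card]
  let TT : ZMod (p + 3) → Finset (Fin n) := fun i => (W.erase (f i)).erase (f (i + 1))
  have hTa : ∀ i, f i ∉ TT i := fun i => by simp [TT]
  have hTb : ∀ i, f (i + 1) ∉ TT i := fun i => by simp [TT]
  have hTc : ∀ i, (TT i).card = p + 1 := by
    intro i
    rw [Finset.card_erase_of_mem, Finset.card_erase_of_mem (hWm i), hWc]
    · omega
    · exact Finset.mem_erase.2 ⟨(hne1 i).symm, hWm _⟩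
  have hib : ∀ i, insert (f (i + 1)) (TT i) = W.erase (f i) := fun i =>
    Finset.insert_erase (Finset.mem_erase.2 ⟨(hne1 i).symm, hWm _⟩)
  have hia : ∀ i, insert (f i) (TT i) = W.erase (f (i + 1)) := fun i => by
    simp only [TT]
    rw [Finset.erase_right_comm]
    exact Finset.insert_erase (Finset.mem_erase.2 ⟨hne1 i, hWm _⟩)
  let c0 : Finset (Fin n) → MvPolynomial (Fin n) K :=
    fun T => if T = TT 0 then X (f 0) * X (f (0 + 1)) else 0
  have hgen : ∀ {i j : Fin n}, Gᶜ.Adj i j →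
      (X i * X j : MvPolynomial (Fin n) K) ∈ edgeIdeal K Gᶜ :=
    fun {i j} hij => Ideal.subset_span ⟨i, j, hij, rfl⟩
  -- the Koszul cycle has coefficients in `m I`
  have hz : ∀ T : Finset (Fin n), T.card = p → kd K c0 T ∈ mS (LinearMap.range R.ε) := by
    intro T _
    rw [R.range_ε]
    unfold kd
    refine Submodule.sum_mem _ fun t ht => zsmul_mem ?_ _
    simp only [c0]
    split_ifs with hT
    · have htT : t ∈ TT 0 := hT ▸ Finset.mem_insert_self _ _
      simp only [TT, Finset.mem_erase] at htT
      obtain ⟨ht1, ht0, htW⟩ := htT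
      rw [hW, Finset.mem_map] at htW
      obtain ⟨j, -, rfl⟩ := htW
      by_cases hadj : G.Adj (f j) (f 0)
      · have hadj' : ¬ G.Adj (f j) (f (0 + 1)) := by
          intro h2
          rw [hf] at hadj h2
          have hj0 := hadj.1
          have hj1 := h2.1
          rcases hadj.2 with h3 | h3 <;> rcases h2.2 with h4 | h4
          · apply z1; linear_combination h3 - h4
          · apply hj1; linear_combination h3
          · apply z3; linear_combination -h4 - h3
          · apply hj0; linear_combination -h4
        have : (X (f j) : MvPolynomial (Fin n) K) • (X (f 0) * X (f (0 + 1)) : MvPolynomial (Fin n) K)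
            = (X (f 0) : MvPolynomial (Fin n) K) • (X (f j) * X (f (0 + 1)) : MvPolynomial (Fin n) K) := by
          simp only [smul_eq_mul]; ring
        rw [this]
        exact X_smul_mem_mS _ (hgen ((SimpleGraph.compl_adj _ _ _).2 ⟨ht1, hadj'⟩))
      · have : (X (f j) : MvPolynomial (Fin n) K) • (X (f 0) * X (f (0 + 1)) : MvPolynomial (Fin n) K)
            = (X (f (0 + 1)) : MvPolynomial (Fin n) K) • (X (f j) * X (f 0) : MvPolynomial (Fin n) K) := by
          simp only [smul_eq_mul]; ring
        rw [this]
        exact X_smul_mem_mS _ (hgen ((SimpleGraph.compl_adj _ _ _).2 ⟨ht0, hadj⟩))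
    · rw [smul_zero]; exact Submodule.zero_mem _
  obtain ⟨v, hv, hv2⟩ := main_ind R.ι R.d R.exact_d lin p 0 _ R.ε R.exact_ε (kd K c0) hz
    (fun T _ => kd_kd c0 T)
  obtain ⟨u, hu⟩ := koszul_exact_self p (fun T => c0 T - v T) (by
    intro T hT
    rw [kd_sub, hv2 T hT, sub_self])
  let σ : ZMod (p + 3) → ℤ := fun i => sg (f i) (TT i) * sg (f (i + 1)) (insert (f i) (TT i))
  let g : Fin n → K := fun a => sg a (W.erase a) • coeff (Finsupp.single a 1) (u (W.erase a))
  have hsum1 : ∑ i, σ i • coeff (Finsupp.single (f i) 1 + Finsupp.single (f (i + 1)) 1)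
      (c0 (TT i) - v (TT i)) = 0 := by
    have : ∀ i, σ i • coeff (Finsupp.single (f i) 1 + Finsupp.single (f (i + 1)) 1)
      (c0 (TT i) - v (TT i)) = g (f (i + 1)) - g (f i) := by
      intro i
      rw [← hu _ (hTc i)]
      simp only [σ, g]
      rw [sg_coeff_kd u (hne1 i) (hTa i) (hTb i), hia, hib]
    simp only [this]
    rw [Finset.sum_sub_distrib, sub_eq_zero]
    exact Equiv.sum_comp (Equiv.addRight (1 : ZMod (p + 3))) (fun i => g (f i))
  have hv0 : ∀ i, coeff (Finsupp.single (f i) 1 + Finsupp.single (f (i + 1)) 1) (v (TT i)) = 0 :=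
    fun i => coeff_edgeIdeal Gᶜ (by rw [← R.range_ε]; exact hv _) (hadj1 i)
  rw [Finset.sum_eq_single 0] at hsum1
  · rw [coeff_sub, hv0, sub_zero] at hsum1
    simp only [c0, if_true] at hsum1
    rw [coeff_X_mul, coeff_X', if_pos rfl, zsmul_eq_mul, mul_one] at hsum1
    have hs : σ 0 * σ 0 = 1 := by
      simp only [σ]
      rw [mul_mul_mul_comm, sg_mul_self, sg_mul_self, one_mul]
    have hs2 : ((σ 0 * σ 0 : ℤ) : K) = 1 := by rw [hs]; simp
    rw [Int.cast_mul, hsum1] at hs2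
    simp at hs2
  · intro i _ hi
    rw [coeff_sub, hv0, sub_zero]
    have hT : TT i ≠ TT 0 := by
      intro hT
      have h1 := hTa i
      have h2 := hTb i
      rw [hT] at h1 h2
      simp only [TT, Finset.mem_erase, hWm, and_true, not_and, not_not, ne_eq,
        EmbeddingLike.apply_eq_iff_eq] at h1 h2
      have hi1 : i = 1 := by
        by_contra hc
        exact hi (h1 (by simpa using hc))
      subst hi1
      have : (1 : ZMod (p + 3)) + 1 = 0 := h2 (by intro h; apply z1; linear_combination h)
      apply z2
      linear_combination this
    simp only [c0, if_neg hT, coeff_zero, smul_zero]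
  · simp
end
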